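/- Let H be a real Hilbert space, A : H → H a continuous self-adjoint nonnegative linear operator, 0 ≤ p ≤ 1, γ ≥ 1, and u₀, u₁ ∈ H with ⟨Au₀,u₀⟩ > 0. Assume in addition that either A is coercive (there exists ν > 0 with ⟨Ax,x⟩ ≥ ν|x|² for all x) or 0 ≤ p ≤ (γ²+1)/(γ²+2γ−1). Let u be the global solution of the parabolic problem u'(t) + (1+t)^{p} ⟨Au(t),u(t)⟩^γ A u(t) = 0, u(0) = u₀. Then there exist ε₀ > 0 and a constant C₄ > 0 such that for every ε ∈ (0,ε₀) and every global C² solution u_ε of the hyperbolic problem with data (u₀,u₁), setting ρ_ε := u_ε − u and r_ε := u_ε − u − θ_ε (θ_ε the corrector), one has for all t ≥ 0: |ρ_ε(t)|² + ⟨Aρ_ε(t),ρ_ε(t)⟩ + ∫₀^t |r_ε'(s)|² ⟨Au(s),u(s)⟩^{-γ} (1+s)^{-p} ds ≤ C₄ ε². -/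

import Mathlib

open Real MeasureTheory intervalIntegral
open scoped RealInnerProductSpace

/-- `u` (with derivatives `u'`, `u''`) is a global C² solution on `[0,∞)` of the
hyperbolic Cauchy problem
`ε u'' + (1+t)^{-p} u' + ⟨Au,u⟩^γ A u = 0`, `u(0) = u₀`, `u'(0) = u₁`. -/
def IsHypSolution {H : Type*} [NormedAddCommGroup H] [InnerProductSpace ℝ H]
    (A : H →L[ℝ] H) (p γ ε : ℝ) (u₀ u₁ : H) (u u' u'' : ℝ → H) : Prop :=
  u 0 = u₀ ∧ u' 0 = u₁ ∧
  (∀ t ∈ Set.Ici (0:ℝ), HasDerivWithinAt u (u' t) (Set.Ici 0) t) ∧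
  (∀ t ∈ Set.Ici (0:ℝ), HasDerivWithinAt u' (u'' t) (Set.Ici 0) t) ∧
  ContinuousOn u'' (Set.Ici 0) ∧
  (∀ t ∈ Set.Ici (0:ℝ),
    ε • u'' t + ((1+t) ^ (-p)) • u' t + (⟪A (u t), u t⟫ ^ γ) • A (u t) = 0)

/-- `u` (with derivative `u'`) is a global C¹ solution on `[0,∞)` of the parabolic
Cauchy problem `u' + (1+t)^{p} ⟨Au,u⟩^γ A u = 0`, `u(0) = u₀`. -/
def IsParSolution {H : Type*} [NormedAddCommGroup H] [InnerProductSpace ℝ H]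
    (A : H →L[ℝ] H) (p γ : ℝ) (u₀ : H) (u u' : ℝ → H) : Prop :=
  u 0 = u₀ ∧
  (∀ t ∈ Set.Ici (0:ℝ), HasDerivWithinAt u (u' t) (Set.Ici 0) t) ∧
  ContinuousOn u' (Set.Ici 0) ∧
  (∀ t ∈ Set.Ici (0:ℝ),
    u' t + ((1+t) ^ p * ⟪A (u t), u t⟫ ^ γ) • A (u t) = 0)

/-- `θ` (with derivatives `θ'`, `θ''`) is the corrector: the solution of
`ε θ'' + (1+t)^{-p} θ' = 0`, `θ(0) = 0`, `θ'(0) = w₀`. -/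
def IsCorrector {H : Type*} [NormedAddCommGroup H] [InnerProductSpace ℝ H]
    (p ε : ℝ) (w₀ : H) (θ θ' θ'' : ℝ → H) : Prop :=
  θ 0 = 0 ∧ θ' 0 = w₀ ∧
  (∀ t ∈ Set.Ici (0:ℝ), HasDerivWithinAt θ (θ' t) (Set.Ici 0) t) ∧
  (∀ t ∈ Set.Ici (0:ℝ), HasDerivWithinAt θ' (θ'' t) (Set.Ici 0) t) ∧
  (∀ t ∈ Set.Ici (0:ℝ), ε • θ'' t + ((1+t) ^ (-p)) • θ' t = 0)

lemma inner_map_sq_le {H : Type*} [NormedAddCommGroup H] [InnerProductSpace ℝ H]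
    (A : H →L[ℝ] H) (hA_sa : ∀ x y : H, ⟪A x, y⟫ = ⟪x, A y⟫) (hA_nn : ∀ x : H, 0 ≤ ⟪A x, x⟫)
    (x y : H) : ⟪A x, y⟫ ^ 2 ≤ ⟪A x, x⟫ * ⟪A y, y⟫ := by
  have h : ∀ r : ℝ, 0 ≤ ⟪A y, y⟫ * (r * r) + (2 * ⟪A x, y⟫) * r + ⟪A x, x⟫ := by
    intro r
    have h1 := hA_nn (x + r • y)
    have h2 : ⟪A y, x⟫ = ⟪A x, y⟫ := by rw [hA_sa, real_inner_comm]
    simp only [map_add, map_smul, inner_add_left, inner_add_right, real_inner_smul_left,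
      real_inner_smul_right, h2] at h1
    linarith
  have := discrim_le_zero h
  rw [discrim] at this
  linarith

lemma norm_map_sq_le {H : Type*} [NormedAddCommGroup H] [InnerProductSpace ℝ H]
    (A : H →L[ℝ] H) (hA_sa : ∀ x y : H, ⟪A x, y⟫ = ⟪x, A y⟫) (hA_nn : ∀ x : H, 0 ≤ ⟪A x, x⟫)
    (x : H) : ‖A x‖ ^ 2 ≤ ‖A‖ * ⟪A x, x⟫ := by
  have h := inner_map_sq_le A hA_sa hA_nn x (A x)
  rw [real_inner_self_eq_norm_sq] at h
  have h2 : ⟪A (A x), A x⟫ ≤ ‖A‖ * ‖A x‖ ^ 2 := by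
    refine (real_inner_le_norm _ _).trans ?_
    have := A.le_opNorm (A x)
    nlinarith [norm_nonneg (A x)]
  rcases (norm_nonneg (A x)).eq_or_lt with h0 | h0
  · rw [← h0]; simpa using mul_nonneg (norm_nonneg A) (hA_nn x)
  · have h3 := mul_le_mul_of_nonneg_left h2 (hA_nn x)
    have h4 : 0 < ‖A x‖ ^ 2 := by positivity
    have h5 : ‖A x‖ ^ 2 * ‖A x‖ ^ 2 ≤ (‖A‖ * ⟪A x, x⟫) * ‖A x‖ ^ 2 := by linarith
    exact le_of_mul_le_mul_right h5 h4

lemma HasDerivWithinAt.continuousOn_Icc {f f' : ℝ → ℝ} {a T : ℝ} (ha : 0 ≤ a)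
    (hf : ∀ t ∈ Set.Icc a T, HasDerivWithinAt f (f' t) (Set.Ici 0) t) :
    ContinuousOn f (Set.Icc a T) :=
  fun t ht => ((hf t ht).continuousWithinAt).mono fun _ hx => ha.trans hx.1

lemma le_initial_of_deriv_nonpos {f f' : ℝ → ℝ} {a T : ℝ} (ha : 0 ≤ a) (hT : a ≤ T)
    (hf : ∀ t ∈ Set.Icc a T, HasDerivWithinAt f (f' t) (Set.Ici 0) t)
    (h : ∀ t ∈ Set.Icc a T, f' t ≤ 0) : f T ≤ f a := by
  have := image_le_of_deriv_right_le_deriv_boundary (a := a) (b := T) (f := f) (f' := f')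
    (HasDerivWithinAt.continuousOn_Icc ha hf)
    (fun x hx => (hf x ⟨hx.1, hx.2.le⟩).mono (Set.Ici_subset_Ici.2 (ha.trans hx.1)))
    (B := fun _ => f a) (B' := fun _ => 0) le_rfl continuousOn_const
    (fun x _ => hasDerivWithinAt_const _ _ _) (fun x hx => h x ⟨hx.1, hx.2.le⟩)
  exact this ⟨hT, le_rfl⟩

lemma initial_le_of_deriv_nonneg {f f' : ℝ → ℝ} {a T : ℝ} (ha : 0 ≤ a) (hT : a ≤ T)
    (hf : ∀ t ∈ Set.Icc a T, HasDerivWithinAt f (f' t) (Set.Ici 0) t)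
    (h : ∀ t ∈ Set.Icc a T, 0 ≤ f' t) : f a ≤ f T := by
  have := le_initial_of_deriv_nonpos (f := fun t => -f t) (f' := fun t => -f' t) ha hT
    (fun t ht => (hf t ht).neg) (fun t ht => by linarith [h t ht])
  linarith

lemma abs_le_of_deriv_neg_of_abs_eq {q q' : ℝ → ℝ} {T M : ℝ} (hT : 0 ≤ T)
    (hq : ∀ t ∈ Set.Icc 0 T, HasDerivWithinAt q (q' t) (Set.Ici 0) t) (h0 : |q 0| ≤ M)
    (h : ∀ t ∈ Set.Icc 0 T, |q t| = M → q t * q' t < 0) : |q T| ≤ M := by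
  have hM : 0 ≤ M := (abs_nonneg _).trans h0
  have hd : ∀ t ∈ Set.Icc 0 T,
      HasDerivWithinAt (fun t => q t ^ 2) (2 * (q t * q' t)) (Set.Ici 0) t := by
    intro t ht
    refine ((hq t ht).fun_pow 2).congr_deriv ?_
    push_cast; ring
  have := image_le_of_deriv_right_lt_deriv_boundary' (a := 0) (b := T) (f := fun t => q t ^ 2)
    (f' := fun t => 2 * (q t * q' t))
    (HasDerivWithinAt.continuousOn_Icc le_rfl hd)
    (fun x hx => (hd x ⟨hx.1, hx.2.le⟩).mono (Set.Ici_subset_Ici.2 hx.1))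
    (B := fun _ => M ^ 2) (B' := fun _ => 0) (sq_le_sq' (abs_le.1 h0).1 (abs_le.1 h0).2)
    continuousOn_const (fun x _ => hasDerivWithinAt_const _ _ _)
    (fun x hx hx2 => by
      have := h x ⟨hx.1, hx.2.le⟩ (by
        have h3 : |q x| ^ 2 = M ^ 2 := by rw [sq_abs]; exact hx2
        exact (pow_left_inj₀ (abs_nonneg _) hM two_ne_zero).1 h3)
      linarith)
  exact abs_le_of_sq_le_sq (this ⟨hT, le_rfl⟩) hM

lemma pos_of_bootstrap {h : ℝ → ℝ} (hc : ContinuousOn h (Set.Ici 0))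
    (hb : ∀ T, 0 ≤ T → (∀ t ∈ Set.Ico 0 T, 0 < h t) → 0 < h T) : ∀ t, 0 ≤ t → 0 < h t := by
  intro t ht
  by_contra hcon
  push Not at hcon
  set S := {x | x ∈ Set.Icc 0 t ∧ h x ≤ 0} with hS
  have hSc : IsClosed S := by
    have := (hc.mono (Set.Icc_subset_Ici_self : Set.Icc 0 t ⊆ _)).preimage_isClosed_of_isClosed
      isClosed_Icc (isClosed_Iic (a := (0 : ℝ)))
    exact this
  have hne : S.Nonempty := ⟨t, ⟨ht, le_rfl⟩, hcon⟩
  have hbd : BddBelow S := ⟨0, fun x hx => hx.1.1⟩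
  have hmem := hSc.csInf_mem hne hbd
  have := hb (sInf S) hmem.1.1 (fun x hx => by
    by_contra hx2
    push Not at hx2
    exact absurd (csInf_le hbd (show x ∈ S from ⟨⟨hx.1, hx.2.le.trans hmem.1.2⟩, hx2⟩))
      (not_le.2 hx.2))
  exact absurd hmem.2 (not_le.2 this)

lemma one_add_rpow_bounds {p t : ℝ} (hp0 : 0 ≤ p) (hp1 : p ≤ 1) (ht : 0 ≤ t) :
    1 ≤ (1 + t) ^ p ∧ (1 + t) ^ p ≤ 1 + t := by
  refine ⟨Real.one_le_rpow (by linarith) hp0, ?_⟩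
  calc (1 + t) ^ p ≤ (1 + t) ^ (1 : ℝ) := Real.rpow_le_rpow_of_exponent_le (by linarith) hp1
    _ = 1 + t := Real.rpow_one _

lemma hasDerivWithinAt_one_add_rpow (p : ℝ) {t : ℝ} (ht : 0 ≤ t) :
    HasDerivWithinAt (fun t : ℝ => (1 + t) ^ p) (p * (1 + t) ^ p / (1 + t)) (Set.Ici 0) t := by
  have h1 : HasDerivWithinAt (fun t : ℝ => 1 + t) 1 (Set.Ici 0) t :=
    (hasDerivWithinAt_id t _).const_add 1
  have hs : (0 : ℝ) < 1 + t := by linarith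
  refine (h1.rpow_const (p := p) (Or.inl hs.ne')).congr_deriv ?_
  rw [Real.rpow_sub_one hs.ne']
  ring

lemma HasDerivWithinAt.rpow_of_pos {c : ℝ → ℝ} {c' t : ℝ} {S : Set ℝ} (r : ℝ)
    (hc : HasDerivWithinAt c c' S t) (hpos : 0 < c t) :
    HasDerivWithinAt (fun t => c t ^ r) (r * (c' / c t) * c t ^ r) S t := by
  refine (hc.rpow_const (p := r) (Or.inl hpos.ne')).congr_deriv ?_
  rw [Real.rpow_sub_one hpos.ne']
  ring

/-- The scalar quantities `c = ⟨Aw,w⟩`, `a = ⟨Aw,w'⟩`, `d = ⟨Aw',w'⟩`, `g = |Aw|²`, `f = ⟨Aw,Aw'⟩`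
attached to a solution `w` of the hyperbolic equation, with the relations they satisfy. -/
structure HypScalars (p γ ε : ℝ) (c a d g f : ℝ → ℝ) : Prop where
  deriv_c : ∀ t, 0 ≤ t → HasDerivWithinAt c (2 * a t) (Set.Ici 0) t
  deriv_a : ∀ t, 0 ≤ t →
    HasDerivWithinAt a (d t - (a t / (1 + t) ^ p + c t ^ γ * g t) / ε) (Set.Ici 0) t
  deriv_d : ∀ t, 0 ≤ t →
    HasDerivWithinAt d (-2 * (d t / (1 + t) ^ p + c t ^ γ * f t) / ε) (Set.Ici 0) t
  deriv_g : ∀ t, 0 ≤ t → HasDerivWithinAt g (2 * f t) (Set.Ici 0) t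
  c_nonneg : ∀ t, 0 ≤ t → 0 ≤ c t
  g_nonneg : ∀ t, 0 ≤ t → 0 ≤ g t
  sq_le : ∀ t, 0 ≤ t → a t ^ 2 ≤ c t * d t

/-- The modified Dirichlet quotient `|Aw|²/c + ε (c d - a²) / c^{γ+2}`. -/
noncomputable def dirichletQuotient (γ ε : ℝ) (c a d g : ℝ → ℝ) (t : ℝ) : ℝ :=
  g t / c t + ε * (c t * d t - a t ^ 2) * c t ^ (-γ) / c t ^ 2

namespace HypScalars

variable {p γ ε : ℝ} {c a d g f : ℝ → ℝ}

lemma hasDerivWithinAt_dirichletQuotient (h : HypScalars p γ ε c a d g f) (hε : 0 < ε) {t : ℝ}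
    (ht : 0 ≤ t) (hc : 0 < c t) :
    HasDerivWithinAt (dirichletQuotient γ ε c a d g)
      (-((c t * d t - a t ^ 2) * c t ^ (-γ) / c t ^ 2 *
        (2 / (1 + t) ^ p + 2 * (γ + 2) * ε * (a t / c t)))) (Set.Ici 0) t := by
  have hB : 0 < (1 + t) ^ p := Real.rpow_pos_of_pos (by linarith) _
  have hX : 0 < c t ^ (-γ) := Real.rpow_pos_of_pos hc _
  have hγ : c t ^ γ = (c t ^ (-γ))⁻¹ := by rw [Real.rpow_neg hc.le, inv_inv]
  have dX := (h.deriv_c t ht).rpow_of_pos (-γ) hc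
  have dN := ((h.deriv_c t ht).fun_mul (h.deriv_d t ht)).fun_sub ((h.deriv_a t ht).fun_pow 2)
  have d1 := ((h.deriv_g t ht).fun_div (h.deriv_c t ht) hc.ne').fun_add
    (((dN.const_mul ε).fun_mul dX).fun_div ((h.deriv_c t ht).fun_pow 2) (pow_ne_zero 2 hc.ne'))
  refine d1.congr_deriv ?_
  rw [hγ]
  generalize c t ^ (-γ) = X at *
  generalize (1 + t) ^ p = B at *
  field_simp
  push_cast
  ring

lemma dirichletQuotient_bounds (h : HypScalars p γ ε c a d g f) (hε : 0 < ε) {t : ℝ}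
    (ht : 0 ≤ t) (hc : 0 < c t) :
    0 ≤ (c t * d t - a t ^ 2) * c t ^ (-γ) / c t ^ 2 ∧ g t / c t ≤ dirichletQuotient γ ε c a d g t ∧
    ε * ((c t * d t - a t ^ 2) * c t ^ (-γ) / c t ^ 2) ≤ dirichletQuotient γ ε c a d g t := by
  have hX : 0 < c t ^ (-γ) := Real.rpow_pos_of_pos hc _
  have h1 : 0 ≤ (c t * d t - a t ^ 2) * c t ^ (-γ) / c t ^ 2 :=
    div_nonneg (mul_nonneg (by linarith [h.sq_le t ht]) hX.le) (sq_nonneg _)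
  have h2 : dirichletQuotient γ ε c a d g t =
      g t / c t + ε * ((c t * d t - a t ^ 2) * c t ^ (-γ) / c t ^ 2) := by
    rw [dirichletQuotient]; ring
  have h3 := div_nonneg (h.g_nonneg t ht) hc.le
  have h4 := mul_nonneg hε.le h1
  refine ⟨h1, ?_, ?_⟩ <;> linarith

/-- Smallness of `ε |c'|`, with `c > 0` as a consequence, makes the damping dominate. -/
lemma damping_dominates (hγ : 1 ≤ γ) (hε : 0 < ε) {t : ℝ} (ht : 0 ≤ t)
    (H : 2 * (γ + 2) * ε * (1 + t) ^ p * |a t| < c t) :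
    0 < c t ∧ (γ + 2) * ε * |a t / c t| ≤ 1 / (2 * (1 + t) ^ p) := by
  have hB : 0 < (1 + t) ^ p := Real.rpow_pos_of_pos (by linarith) _
  have hc : 0 < c t := lt_of_le_of_lt (by positivity) H
  refine ⟨hc, ?_⟩
  rw [abs_div, abs_of_pos hc, le_div_iff₀ (by positivity)]
  calc (γ + 2) * ε * (|a t| / c t) * (2 * (1 + t) ^ p)
      = 2 * (γ + 2) * ε * (1 + t) ^ p * |a t| / c t := by ring
    _ ≤ 1 := by rw [div_le_one hc]; exact H.le

lemma deriv_dirichletQuotient_le (h : HypScalars p γ ε c a d g f) (hγ : 1 ≤ γ) (hε : 0 < ε) {t : ℝ}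
    (ht : 0 ≤ t) (H : 2 * (γ + 2) * ε * (1 + t) ^ p * |a t| < c t) :
    -((c t * d t - a t ^ 2) * c t ^ (-γ) / c t ^ 2 *
        (2 / (1 + t) ^ p + 2 * (γ + 2) * ε * (a t / c t))) ≤
    -((c t * d t - a t ^ 2) * c t ^ (-γ) / c t ^ 2 / (1 + t) ^ p) := by
  have hB : 0 < (1 + t) ^ p := Real.rpow_pos_of_pos (by linarith) _
  obtain ⟨hc, h2⟩ := damping_dominates hγ hε ht H
  have h1 := (h.dirichletQuotient_bounds hε ht hc).1
  have h3 : -((γ + 2) * ε * |a t / c t|) ≤ (γ + 2) * ε * (a t / c t) := by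
    have := mul_le_mul_of_nonneg_left (neg_abs_le (a t / c t)) (show 0 ≤ (γ + 2) * ε by positivity)
    linarith
  have h4 : 1 / (2 * (1 + t) ^ p) = 1 / (1 + t) ^ p / 2 := by field_simp
  have h5 : 1 / (1 + t) ^ p ≤ 2 / (1 + t) ^ p + 2 * (γ + 2) * ε * (a t / c t) := by
    have : 2 / (1 + t) ^ p = 2 * (1 / (1 + t) ^ p) := by ring
    rw [this]; linarith
  have h6 := mul_le_mul_of_nonneg_left h5 h1
  have h7 : (c t * d t - a t ^ 2) * c t ^ (-γ) / c t ^ 2 / (1 + t) ^ p =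
    (c t * d t - a t ^ 2) * c t ^ (-γ) / c t ^ 2 * (1 / (1 + t) ^ p) := by ring
  rw [h7]; linarith

lemma dirichletQuotient_antitone (h : HypScalars p γ ε c a d g f) (hγ : 1 ≤ γ) (hε : 0 < ε)
    {t₀ T : ℝ} (ht₀ : 0 ≤ t₀) (hT : t₀ ≤ T)
    (H : ∀ t ∈ Set.Icc 0 T, 2 * (γ + 2) * ε * (1 + t) ^ p * |a t| < c t) :
    dirichletQuotient γ ε c a d g T ≤ dirichletQuotient γ ε c a d g t₀ := by
  have hpos : ∀ t ∈ Set.Icc t₀ T, 0 < c t := fun t ht =>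
    (damping_dominates hγ hε (ht₀.trans ht.1) (H t ⟨ht₀.trans ht.1, ht.2⟩)).1
  refine le_initial_of_deriv_nonpos ht₀ hT (fun t ht =>
    h.hasDerivWithinAt_dirichletQuotient hε (ht₀.trans ht.1) (hpos t ht)) (fun t ht => ?_)
  refine (h.deriv_dirichletQuotient_le hγ hε (ht₀.trans ht.1) (H t ⟨ht₀.trans ht.1, ht.2⟩)).trans ?_
  have h1 := (h.dirichletQuotient_bounds hε (ht₀.trans ht.1) (hpos t ht)).1
  have hB : 0 < (1 + t) ^ p := Real.rpow_pos_of_pos (by linarith [ht.1]) _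
  have := div_nonneg h1 hB.le
  linarith

/-- Growth of `c^{-γ}` in terms of the Dirichlet quotient. -/
lemma dirichletQuotient_mul_le (h : HypScalars p γ ε c a d g f) (hp0 : 0 ≤ p) (hp1 : p ≤ 1)
    (hγ : 1 ≤ γ) (hε : 0 < ε) (hε8 : ε ≤ 1 / 8) {T V : ℝ} (hT : 0 ≤ T) (hV : 0 < V)
    (H : ∀ t ∈ Set.Icc 0 T, 2 * (γ + 2) * ε * (1 + t) ^ p * |a t| < c t)
    (hV0 : V ≤ c 0 ^ (-γ) * (1 - ε * p) / (2 * γ) - ε * (a 0 / c 0) * c 0 ^ (-γ)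
      - 2 * ε * dirichletQuotient γ ε c a d g 0) :
    dirichletQuotient γ ε c a d g T * ((1 + T) ^ p * (1 + T)) ≤
      (4 + dirichletQuotient γ ε c a d g 0 / V) * c T ^ (-γ) := by
  set G := dirichletQuotient γ ε c a d g with hG
  have hdom : ∀ t ∈ Set.Icc 0 T, 0 < c t ∧ (γ + 2) * ε * |a t / c t| ≤ 1 / (2 * (1 + t) ^ p) :=
    fun t ht => damping_dominates hγ hε ht.1 (H t ht)
  have hGnn : ∀ t ∈ Set.Icc 0 T, 0 ≤ G t := fun t ht =>
    (div_nonneg (h.g_nonneg t ht.1) (hdom t ht).1.le).trans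
      (h.dirichletQuotient_bounds hε ht.1 (hdom t ht).1).2.1
  have hTm : T ∈ Set.Icc 0 T := ⟨hT, le_rfl⟩
  have h0m : (0 : ℝ) ∈ Set.Icc 0 T := ⟨le_rfl, hT⟩
  have key := initial_le_of_deriv_nonneg (a := 0) (T := T)
    (f := fun t => c t ^ (-γ) * (1 - ε * (p * ((1 + t) ^ p / (1 + t)))) / (2 * γ)
      - ε * (1 + t) ^ p * (a t / c t) * c t ^ (-γ) - 2 * ε * ((1 + t) ^ p) ^ 2 * G t
      - G T * ((1 + t) ^ p * (1 + t)) / 4)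
    (f' := fun t => c t ^ (-γ) * ε * (p * (1 - p)) * (1 + t) ^ p / (1 + t) ^ 2 / (2 * γ)
      + (1 + t) ^ p * (g t / c t - ε * ((c t * d t - a t ^ 2) * c t ^ (-γ) / c t ^ 2))
      + (2 * γ + 1) * ε * (1 + t) ^ p * (a t / c t) ^ 2 * c t ^ (-γ)
      - 4 * ε * p * ((1 + t) ^ p) ^ 2 / (1 + t) * G t
      + 2 * ε * ((1 + t) ^ p) ^ 2 * ((c t * d t - a t ^ 2) * c t ^ (-γ) / c t ^ 2 *
        (2 / (1 + t) ^ p + 2 * (γ + 2) * ε * (a t / c t)))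
      - G T * ((p + 1) * (1 + t) ^ p) / 4) le_rfl hT ?_ ?_
  · have hb := (hdom T hTm).2
    have hc := (hdom T hTm).1
    obtain ⟨hB1, hB2⟩ := one_add_rpow_bounds hp0 hp1 hT
    have hX : 0 < c T ^ (-γ) := Real.rpow_pos_of_pos hc _
    have hGT := hGnn T hTm
    have hG0 := hGnn 0 h0m
    have hGG : G T ≤ G 0 := h.dirichletQuotient_antitone hγ hε le_rfl hT H
    simp only [add_zero, Real.one_rpow, one_pow, mul_one, div_one] at key
    generalize c T ^ (-γ) = X at *
    generalize (1 + T) ^ p = B at *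
    have hBs : 0 ≤ B / (1 + T) := by positivity
    have e1 : X * (1 - ε * (p * (B / (1 + T)))) / (2 * γ) ≤ X / 2 := by
      rw [div_le_div_iff₀ (by positivity) two_pos]
      have : 0 ≤ ε * (p * (B / (1 + T))) := by positivity
      nlinarith [mul_nonneg hX.le this]
    have e2 : -(ε * B * (a T / c T) * X) ≤ X / 6 := by
      have h1 : (γ + 2) * ε * |a T / c T| * B ≤ 1 / 2 := by
        have := mul_le_mul_of_nonneg_right hb (show 0 ≤ B by linarith)
        rwa [show 1 / (2 * B) * B = 1 / 2 by field_simp] at this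
      have h2 : 3 * (ε * |a T / c T| * B) ≤ (γ + 2) * ε * |a T / c T| * B := by
        have : 0 ≤ ε * |a T / c T| * B := by positivity
        nlinarith
      have h3 : -(ε * B * (a T / c T)) ≤ ε * |a T / c T| * B := by
        have := mul_le_mul_of_nonneg_left (neg_abs_le (a T / c T)) (show 0 ≤ ε * B by positivity)
        linarith
      nlinarith
    have e3 : 0 ≤ 2 * ε * B ^ 2 * G T := by positivity
    have e4 : V + G T * (B * (1 + T)) / 4 - G T / 4 ≤ X := by linarith
    have e5 : 0 ≤ G T * (B * (1 + T) - 1) := by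
      refine mul_nonneg hGT ?_
      nlinarith
    have e6 : V ≤ X := by linarith
    have e7 : G T ≤ G 0 / V * X := by
      rw [div_mul_eq_mul_div, le_div_iff₀ hV]
      nlinarith
    linarith
  · intro t ht
    have hc := (hdom t ht).1
    have hs : 0 < 1 + t := by linarith [ht.1]
    have hB : 0 < (1 + t) ^ p := Real.rpow_pos_of_pos hs _
    have hX : 0 < c t ^ (-γ) := Real.rpow_pos_of_pos hc _
    have hγ' : c t ^ γ = (c t ^ (-γ))⁻¹ := by rw [Real.rpow_neg hc.le, inv_inv]
    have dX := (h.deriv_c t ht.1).rpow_of_pos (-γ) hc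
    have dB := hasDerivWithinAt_one_add_rpow p ht.1
    have ds : HasDerivWithinAt (fun t : ℝ => 1 + t) 1 (Set.Ici 0) t :=
      (hasDerivWithinAt_id t _).const_add 1
    have dy := (h.deriv_a t ht.1).fun_div (h.deriv_c t ht.1) hc.ne'
    have dG := h.hasDerivWithinAt_dirichletQuotient hε ht.1 hc
    have d1 := (dX.fun_mul ((((dB.fun_div ds hs.ne').const_mul p).const_mul ε).const_sub 1)).div_const
      (2 * γ)
    have d2 := ((dB.const_mul ε).fun_mul dy).fun_mul dX
    have d3 := ((dB.fun_pow 2).const_mul (2 * ε)).fun_mul dG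
    have d4 := ((dB.fun_mul ds).const_mul (G T)).div_const 4
    refine (((d1.fun_sub d2).fun_sub d3).fun_sub d4).congr_deriv ?_
    rw [hγ', ← hG]
    generalize c t ^ (-γ) = X at *
    generalize (1 + t) ^ p = B at *
    generalize G t = Gt at *
    generalize G T = GT at *
    have : γ ≠ 0 := by linarith
    push_cast
    field_simp
    ring
  · intro t ht
    have hc := (hdom t ht).1
    have hs : 0 < 1 + t := by linarith [ht.1]
    obtain ⟨hB1, hB2⟩ := one_add_rpow_bounds hp0 hp1 ht.1
    have hB : 0 < (1 + t) ^ p := Real.rpow_pos_of_pos hs _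
    have hX : 0 < c t ^ (-γ) := Real.rpow_pos_of_pos hc _
    have hGt := hGnn t ht
    have hGG : G T ≤ G t := h.dirichletQuotient_antitone hγ hε ht.1 ht.2 H
    have hder := h.deriv_dirichletQuotient_le hγ hε ht.1 (H t ht)
    have hGdef : G t = g t / c t + ε * ((c t * d t - a t ^ 2) * c t ^ (-γ) / c t ^ 2) := by
      rw [hG, dirichletQuotient]; ring
    have hN := (h.dirichletQuotient_bounds hε ht.1 hc).1
    generalize (c t * d t - a t ^ 2) * c t ^ (-γ) / c t ^ 2 = N at *
    generalize (2 / (1 + t) ^ p + 2 * (γ + 2) * ε * (a t / c t)) = D at *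
    have e1 : 0 ≤ c t ^ (-γ) * ε * (p * (1 - p)) * (1 + t) ^ p / (1 + t) ^ 2 / (2 * γ) := by
      have : 0 ≤ 1 - p := by linarith
      positivity
    have e2 : 0 ≤ (2 * γ + 1) * ε * (1 + t) ^ p * (a t / c t) ^ 2 * c t ^ (-γ) := by positivity
    generalize (1 + t) ^ p = B at *
    have e3 : 4 * ε * p * B ^ 2 / (1 + t) * G t ≤ B * G t / 2 := by
      have : 4 * ε * p * B ^ 2 / (1 + t) ≤ B / 2 := by
        rw [div_le_div_iff₀ hs two_pos]
        have h1 : ε * p ≤ 1 / 8 := by nlinarith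
        have h2 : ε * p * (B * B) ≤ 1 / 8 * (B * (1 + t)) := by
          refine mul_le_mul h1 ?_ (by positivity) (by norm_num)
          exact mul_le_mul_of_nonneg_left hB2 hB.le
        nlinarith
      nlinarith
    have e4 : 2 * ε * B * N ≤ 2 * ε * B ^ 2 * (N * D) := by
      have : N / B ≤ N * D := by linarith
      have h1 := mul_le_mul_of_nonneg_left this (show 0 ≤ 2 * ε * B ^ 2 by positivity)
      rwa [show 2 * ε * B ^ 2 * (N / B) = 2 * ε * B * N by field_simp] at h1
    have e5 : G T * ((p + 1) * B) / 4 ≤ B * G t / 2 := by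
      have h1 : G T * ((p + 1) * B) ≤ G t * (2 * B) := by
        refine mul_le_mul hGG ?_ (by positivity) hGt
        nlinarith
      linarith
    have e6 : B * (g t / c t - ε * N) + 2 * ε * B * N = B * G t := by rw [hGdef]; ring
    linarith

lemma abs_mul_le (h : HypScalars p γ ε c a d g f) (hp0 : 0 ≤ p) (hp1 : p ≤ 1)
    (hγ : 1 ≤ γ) (hε : 0 < ε) (hε8 : ε ≤ 1 / 8) {T C M : ℝ} (hT : 0 ≤ T) (hC : 0 ≤ C)
    (hMC : 2 * C < M) (hM0 : |a 0 / c 0| ≤ M)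
    (H : ∀ t ∈ Set.Icc 0 T, 2 * (γ + 2) * ε * (1 + t) ^ p * |a t| < c t)
    (hG : ∀ t ∈ Set.Icc 0 T,
      dirichletQuotient γ ε c a d g t * ((1 + t) ^ p * (1 + t)) ≤ C * c t ^ (-γ)) :
    |a T| * (1 + T) ≤ M * c T := by
  have hdom : ∀ t ∈ Set.Icc 0 T, 0 < c t ∧ (γ + 2) * ε * |a t / c t| ≤ 1 / (2 * (1 + t) ^ p) :=
    fun t ht => damping_dominates hγ hε ht.1 (H t ht)
  have key := abs_le_of_deriv_neg_of_abs_eq (T := T) (M := M) (q := fun t => (1 + t) * (a t / c t))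
    (q' := fun t => a t / c t + (1 + t) * ((c t * d t - a t ^ 2) / c t ^ 2 - (a t / c t) ^ 2
      - (a t / c t / (1 + t) ^ p + (c t ^ (-γ))⁻¹ * (g t / c t)) / ε)) hT ?_ (by simpa using hM0) ?_
  · have hc := (hdom T ⟨hT, le_rfl⟩).1
    rw [abs_mul, abs_div, abs_of_pos hc, abs_of_pos (by linarith : 0 < 1 + T)] at key
    rw [← mul_div_assoc, div_le_iff₀ hc] at key
    linarith
  · intro t ht
    have hc := (hdom t ht).1
    have hs : 0 < 1 + t := by linarith [ht.1]
    have hB : 0 < (1 + t) ^ p := Real.rpow_pos_of_pos hs _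
    have hX : 0 < c t ^ (-γ) := Real.rpow_pos_of_pos hc _
    have hγ' : c t ^ γ = (c t ^ (-γ))⁻¹ := by rw [Real.rpow_neg hc.le, inv_inv]
    have ds : HasDerivWithinAt (fun t : ℝ => 1 + t) 1 (Set.Ici 0) t :=
      (hasDerivWithinAt_id t _).const_add 1
    refine (ds.fun_mul ((h.deriv_a t ht.1).fun_div (h.deriv_c t ht.1) hc.ne')).congr_deriv ?_
    rw [hγ']
    field_simp
    ring
  · intro t ht hq
    obtain ⟨hc, hy⟩ := hdom t ht
    have hs : 0 < 1 + t := by linarith [ht.1]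
    obtain ⟨hB1, hB2⟩ := one_add_rpow_bounds hp0 hp1 ht.1
    have hB : 0 < (1 + t) ^ p := Real.rpow_pos_of_pos hs _
    have hX : 0 < c t ^ (-γ) := Real.rpow_pos_of_pos hc _
    have hGt := hG t ht
    have hGdef : dirichletQuotient γ ε c a d g t
        = g t / c t + ε * ((c t * d t - a t ^ 2) / c t ^ 2 * c t ^ (-γ)) := by
      rw [dirichletQuotient]; ring
    have hN : 0 ≤ (c t * d t - a t ^ 2) / c t ^ 2 :=
      div_nonneg (by linarith [h.sq_le t ht.1]) (sq_nonneg _)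
    have hφ := div_nonneg (h.g_nonneg t ht.1) hc.le
    rw [hGdef] at hGt
    generalize (c t * d t - a t ^ 2) / c t ^ 2 = N at *
    generalize g t / c t = φ at *
    generalize a t / c t = y at *
    generalize c t ^ (-γ) = X at *
    generalize (1 + t) ^ p = B at *
    generalize 1 + t = s at *
    have hM : 0 < M := by linarith
    have hR : |ε * N - X⁻¹ * φ| * s ≤ C / B := by
      have h1 : |ε * N - X⁻¹ * φ| ≤ ε * N + X⁻¹ * φ := by
        have h2 := mul_nonneg hε.le hN
        have h3 := mul_nonneg (inv_pos.2 hX).le hφ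
        rw [abs_le]; constructor <;> linarith
      rw [le_div_iff₀ hB]
      have h4 : (ε * N + X⁻¹ * φ) * (B * s) ≤ C := by
        have := mul_le_mul_of_nonneg_left hGt (inv_pos.2 hX).le
        rw [show X⁻¹ * ((φ + ε * (N * X)) * (B * s)) = (ε * N + X⁻¹ * φ) * (B * s) by
          field_simp; ring, show X⁻¹ * (C * X) = C by field_simp] at this
        exact this
      have h5 := mul_le_mul_of_nonneg_right h1 (show 0 ≤ B * s by positivity)
      linarith
    have hεy : -(1 / B / 6) ≤ ε * y := by
      have h1 : 3 * (ε * |y|) ≤ (γ + 2) * ε * |y| := by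
        have : 0 ≤ ε * |y| := by positivity
        nlinarith
      have h2 := mul_le_mul_of_nonneg_left (neg_abs_le y) hε.le
      have h3 : 1 / (2 * B) = 1 / B / 2 := by field_simp
      linarith
    have hεs : ε / s ≤ 1 / B / 8 := by
      have h1 : 1 / s ≤ 1 / B := one_div_le_one_div_of_le hB hB2
      have h2 : 0 < 1 / s := by positivity
      have h3 : ε / s = ε * (1 / s) := by ring
      nlinarith
    have hq2 : (s * y) ^ 2 = M ^ 2 := by rw [← sq_abs, hq]
    have e1 : ε * (s * y * (y + s * (N - y ^ 2 - (y / B + X⁻¹ * φ) / ε))) =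
        (s * y) ^ 2 * (ε / s - ε * y - 1 / B) + s * y * ((ε * N - X⁻¹ * φ) * s) := by
      field_simp
      ring
    have e2 : s * y * ((ε * N - X⁻¹ * φ) * s) ≤ M * (C / B) := by
      refine (le_abs_self _).trans ?_
      rw [abs_mul, hq, abs_mul, abs_of_pos hs]
      exact mul_le_mul_of_nonneg_left hR hM.le
    have e3 : (s * y) ^ 2 * (ε / s - ε * y - 1 / B) ≤ M ^ 2 * (-(1 / B / 2)) := by
      rw [hq2]
      refine mul_le_mul_of_nonneg_left ?_ (sq_nonneg M)
      have : 0 < 1 / B := by positivity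
      linarith
    have e4 : M ^ 2 * (-(1 / B / 2)) + M * (C / B) = -(M * (M - 2 * C) / (2 * B)) := by
      field_simp; ring
    have e5 : 0 < M * (M - 2 * C) / (2 * B) :=
      div_pos (mul_pos hM (by linarith)) (by positivity)
    have e6 : ε * (s * y * (y + s * (N - y ^ 2 - (y / B + X⁻¹ * φ) / ε))) < 0 := by linarith
    by_contra hcon
    push Not at hcon
    linarith [mul_nonneg hε.le hcon]

lemma initial_mul_le (h : HypScalars p γ ε c a d g f) {T M : ℝ} (hT : 0 ≤ T)
    (hM : ∀ t ∈ Set.Icc 0 T, |a t| * (1 + t) ≤ M * c t) : c 0 ≤ c T * (1 + T) ^ (2 * M) := by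
  have := initial_le_of_deriv_nonneg (a := 0) (T := T) (f := fun t => c t * (1 + t) ^ (2 * M))
    (f' := fun t => 2 * a t * (1 + t) ^ (2 * M) + c t * (2 * M * (1 + t) ^ (2 * M) / (1 + t)))
    le_rfl hT (fun t ht => (h.deriv_c t ht.1).fun_mul (hasDerivWithinAt_one_add_rpow _ ht.1)) ?_
  · simpa using this
  · intro t ht
    have hs : 0 < 1 + t := by linarith [ht.1]
    have hB : 0 < (1 + t) ^ (2 * M) := Real.rpow_pos_of_pos hs _
    have e : 2 * a t * (1 + t) ^ (2 * M) + c t * (2 * M * (1 + t) ^ (2 * M) / (1 + t)) =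
      2 * ((1 + t) ^ (2 * M) / (1 + t)) * (a t * (1 + t) + M * c t) := by field_simp
    rw [e]
    have h1 := hM t ht
    have h2 := mul_le_mul_of_nonneg_right (neg_abs_le (a t)) hs.le
    have h3 : 0 ≤ a t * (1 + t) + M * c t := by linarith
    positivity

end HypScalars

/-- Decay estimates for the hyperbolic problem, uniform in `ε`. -/
theorem exists_hypScalars_bounds {p γ c₀ a₀ d₀ g₀ : ℝ} (hp0 : 0 ≤ p) (hp1 : p ≤ 1) (hγ : 1 ≤ γ)
    (hc₀ : 0 < c₀) (hg₀ : 0 ≤ g₀) (had : a₀ ^ 2 ≤ c₀ * d₀) :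
    ∃ ε₀ > 0, ∃ M > 0, ∃ C > 0, ∀ ε, 0 < ε → ε < ε₀ → ∀ c a d g f : ℝ → ℝ,
      HypScalars p γ ε c a d g f → c 0 = c₀ → a 0 = a₀ → d 0 = d₀ → g 0 = g₀ →
      ∀ t, 0 ≤ t → 0 < c t ∧ |a t| * (1 + t) ≤ M * c t ∧
        g t / c t * ((1 + t) ^ p * (1 + t)) ≤ C * c t ^ (-γ) := by
  have hX0 : 0 < c₀ ^ (-γ) := Real.rpow_pos_of_pos hc₀ _
  set X₀ := c₀ ^ (-γ) with hX₀
  set N₀ := (c₀ * d₀ - a₀ ^ 2) * X₀ / c₀ ^ 2 with hN₀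
  have hN0 : 0 ≤ N₀ := div_nonneg (mul_nonneg (by linarith) hX0.le) (sq_nonneg _)
  set Gm := g₀ / c₀ + N₀ with hGm
  have hGm0 : 0 ≤ Gm := add_nonneg (div_nonneg hg₀ hc₀.le) hN0
  set V := X₀ / (8 * γ) with hV
  have hV0 : 0 < V := by positivity
  set C := 4 + Gm / V with hC
  have hC0 : 0 < C := by positivity
  set M := |a₀ / c₀| + 2 * C + 1 with hM
  have hM0 : 0 < M := by positivity
  set K := |a₀ / c₀| * X₀ + 2 * Gm + 1 with hK
  have hK0 : 0 < K := by positivity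
  refine ⟨min (1 / 8) (min (V / K) (1 / (2 * (γ + 2) * M))),
    lt_min (by norm_num) (lt_min (by positivity) (by positivity)), M, hM0, C, hC0, ?_⟩
  intro ε hε hεlt c a d g f h h0c h0a h0d h0g
  obtain ⟨hε8, hεV, hεM⟩ : ε < 1 / 8 ∧ ε < V / K ∧ ε < 1 / (2 * (γ + 2) * M) := by
    simpa only [lt_min_iff] using hεlt
  rw [lt_div_iff₀ hK0] at hεV
  rw [lt_div_iff₀ (by positivity)] at hεM
  have hG0 : dirichletQuotient γ ε c a d g 0 ≤ Gm := by
    have : dirichletQuotient γ ε c a d g 0 = g₀ / c₀ + ε * N₀ := by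
      rw [dirichletQuotient, h0c, h0a, h0d, h0g]; ring
    rw [this]
    nlinarith
  have hV0' : V ≤ c 0 ^ (-γ) * (1 - ε * p) / (2 * γ) - ε * (a 0 / c 0) * c 0 ^ (-γ)
      - 2 * ε * dirichletQuotient γ ε c a d g 0 := by
    rw [h0c, h0a, ← hX₀]
    have e1 : X₀ / (4 * γ) ≤ X₀ * (1 - ε * p) / (2 * γ) := by
      rw [div_le_div_iff₀ (by positivity) (by positivity)]
      have : ε * p ≤ 1 / 2 := by nlinarith
      have h1 : 0 ≤ X₀ * γ * (1 / 2 - ε * p) := mul_nonneg (by positivity) (by linarith)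
      nlinarith
    have e2 : X₀ / (4 * γ) = 2 * V := by rw [hV]; field_simp; ring
    have e3 : ε * (a₀ / c₀) * X₀ ≤ ε * (|a₀ / c₀| * X₀) := by
      have := mul_le_mul_of_nonneg_left (le_abs_self (a₀ / c₀)) (show 0 ≤ ε * X₀ by positivity)
      linarith
    have e4 : ε * dirichletQuotient γ ε c a d g 0 ≤ ε * Gm := mul_le_mul_of_nonneg_left hG0 hε.le
    have e5 : ε * K = ε * (|a₀ / c₀| * X₀) + 2 * (ε * Gm) + ε := by rw [hK]; ring
    linarith
  have apriori : ∀ T, 0 ≤ T →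
      (∀ t ∈ Set.Icc 0 T, 2 * (γ + 2) * ε * (1 + t) ^ p * |a t| < c t) →
      (∀ t ∈ Set.Icc 0 T, |a t| * (1 + t) ≤ M * c t) ∧ ∀ t ∈ Set.Icc 0 T,
        dirichletQuotient γ ε c a d g t * ((1 + t) ^ p * (1 + t)) ≤ C * c t ^ (-γ) := by
    intro T hT H
    have h1 : ∀ t ∈ Set.Icc 0 T,
        dirichletQuotient γ ε c a d g t * ((1 + t) ^ p * (1 + t)) ≤ C * c t ^ (-γ) := by
      intro t ht
      have hc := (HypScalars.damping_dominates hγ hε ht.1 (H t ht)).1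
      refine (h.dirichletQuotient_mul_le hp0 hp1 hγ hε hε8.le ht.1 hV0
        (fun x hx => H x ⟨hx.1, hx.2.trans ht.2⟩) hV0').trans ?_
      refine mul_le_mul_of_nonneg_right ?_ (Real.rpow_nonneg hc.le _)
      rw [hC]
      gcongr
    refine ⟨fun t ht => ?_, h1⟩
    exact h.abs_mul_le hp0 hp1 hγ hε hε8.le ht.1 hC0.le (by rw [hM]; linarith [abs_nonneg (a₀ / c₀)])
      (by rw [h0a, h0c, hM]; linarith)
      (fun x hx => H x ⟨hx.1, hx.2.trans ht.2⟩) (fun x hx => h1 x ⟨hx.1, hx.2.trans ht.2⟩)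
  have improve : ∀ t, 0 ≤ t → 0 < c t → |a t| * (1 + t) ≤ M * c t →
      2 * (γ + 2) * ε * (1 + t) ^ p * |a t| < c t := by
    intro t ht hc hat
    obtain ⟨hB1, hB2⟩ := one_add_rpow_bounds hp0 hp1 ht
    calc 2 * (γ + 2) * ε * (1 + t) ^ p * |a t| ≤ 2 * (γ + 2) * ε * (1 + t) * |a t| := by gcongr
      _ = 2 * (γ + 2) * ε * (|a t| * (1 + t)) := by ring
      _ ≤ 2 * (γ + 2) * ε * (M * c t) := by gcongr
      _ = ε * (2 * (γ + 2) * M) * c t := by ring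
      _ < 1 * c t := by gcongr
      _ = c t := one_mul _
  have cc : ContinuousOn c (Set.Ici 0) := fun t ht => (h.deriv_c t ht).continuousWithinAt
  have ca : ContinuousOn a (Set.Ici 0) := fun t ht => (h.deriv_a t ht).continuousWithinAt
  have cB : ContinuousOn (fun t : ℝ => (1 + t) ^ p) (Set.Ici 0) :=
    fun t ht => (hasDerivWithinAt_one_add_rpow p ht).continuousWithinAt
  have cs : ∀ q : ℝ, ContinuousOn (fun t : ℝ => (1 + t) ^ q) (Set.Ici 0) :=
    fun q t ht => (hasDerivWithinAt_one_add_rpow q ht).continuousWithinAt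
  have hpos := pos_of_bootstrap (h := fun t => c t - 2 * (γ + 2) * ε * (1 + t) ^ p * |a t|)
    (cc.sub ((continuousOn_const.mul cB).mul ca.abs)) (fun T hT hT' => by
      have hIco : ∀ t ∈ Set.Ico 0 T, |a t| * (1 + t) ≤ M * c t ∧ c 0 ≤ c t * (1 + t) ^ (2 * M) := by
        intro t ht
        have := (apriori t ht.1 (fun x hx => by
          have := hT' x ⟨hx.1, hx.2.trans_lt ht.2⟩
          linarith)).1
        exact ⟨this t ⟨ht.1, le_rfl⟩, h.initial_mul_le ht.1 this⟩
      have hT2 : |a T| * (1 + T) ≤ M * c T ∧ c 0 ≤ c T * (1 + T) ^ (2 * M) := by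
        rcases hT.eq_or_lt with rfl | hTpos
        · rw [h0a, h0c]
          refine ⟨?_, by simp⟩
          have e : |a₀| = |a₀ / c₀| * c₀ := by
            rw [abs_div, abs_of_pos hc₀]; field_simp
          rw [e, add_zero, mul_one]
          refine mul_le_mul_of_nonneg_right ?_ hc₀.le
          rw [hM]; linarith
        · have hmem : T ∈ closure (Set.Ico 0 T) := by
            rw [closure_Ico hTpos.ne]; exact ⟨hT, le_rfl⟩
          have hsub : Set.Ico 0 T ⊆ Set.Ici (0 : ℝ) := fun x hx => hx.1
          have k1 := (cc T hT).mono hsub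
          have k2 := (ca T hT).mono hsub
          have k3 : ContinuousWithinAt (fun t : ℝ => 1 + t) (Set.Ico 0 T) T := by fun_prop
          have k4 := (cs (2 * M) T hT).mono hsub
          exact ⟨ContinuousWithinAt.closure_le hmem (k2.abs.mul k3) (continuousWithinAt_const.mul k1)
            (fun x hx => (hIco x hx).1),
            ContinuousWithinAt.closure_le hmem continuousWithinAt_const (k1.mul k4)
            (fun x hx => (hIco x hx).2)⟩
      have hcT : 0 < c T := by
        have h1 : 0 < c T * (1 + T) ^ (2 * M) := by
          refine lt_of_lt_of_le ?_ hT2.2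
          rw [h0c]; exact hc₀
        exact pos_of_mul_pos_left h1 (Real.rpow_nonneg (by linarith) _)
      linarith [improve T hT hcT hT2.1])
  intro t ht
  have H : ∀ x ∈ Set.Icc 0 t, 2 * (γ + 2) * ε * (1 + x) ^ p * |a x| < c x :=
    fun x hx => by linarith [hpos x hx.1]
  have hm : t ∈ Set.Icc 0 t := ⟨ht, le_rfl⟩
  obtain ⟨h1, h2⟩ := apriori t ht H
  have hc := (HypScalars.damping_dominates hγ hε ht (H t hm)).1
  refine ⟨hc, h1 t hm, ?_⟩
  refine le_trans ?_ (h2 t hm)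
  have := (h.dirichletQuotient_bounds hε ht hc).2.1
  have hB : 0 < (1 + t) ^ p := Real.rpow_pos_of_pos (by linarith) _
  gcongr

/-- The scalar quantities `c = ⟨Au,u⟩`, `g = |Au|²`, `h = ⟨A²u,Au⟩`, `l = |A²u|²`, `n = |u|²`
attached to a solution `u` of the parabolic equation, with the relations they satisfy. -/
structure ParScalars (p γ L : ℝ) (c g h l n : ℝ → ℝ) : Prop where
  deriv_c : ∀ t, 0 ≤ t → HasDerivWithinAt c (-2 * ((1 + t) ^ p * c t ^ γ) * g t) (Set.Ici 0) t
  deriv_g : ∀ t, 0 ≤ t → HasDerivWithinAt g (-2 * ((1 + t) ^ p * c t ^ γ) * h t) (Set.Ici 0) t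
  deriv_h : ∀ t, 0 ≤ t → HasDerivWithinAt h (-2 * ((1 + t) ^ p * c t ^ γ) * l t) (Set.Ici 0) t
  deriv_n : ∀ t, 0 ≤ t → HasDerivWithinAt n (-2 * ((1 + t) ^ p * c t ^ γ) * c t) (Set.Ici 0) t
  c_nonneg : ∀ t, 0 ≤ t → 0 ≤ c t
  g_nonneg : ∀ t, 0 ≤ t → 0 ≤ g t
  h_nonneg : ∀ t, 0 ≤ t → 0 ≤ h t
  l_nonneg : ∀ t, 0 ≤ t → 0 ≤ l t
  n_nonneg : ∀ t, 0 ≤ t → 0 ≤ n t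
  sq_le : ∀ t, 0 ≤ t → g t ^ 2 ≤ c t * h t
  g_le : ∀ t, 0 ≤ t → g t ≤ L * c t
  L_nonneg : 0 ≤ L

namespace ParScalars

variable {p γ L : ℝ} {c g h l n : ℝ → ℝ}

lemma c_le (H : ParScalars p γ L c g h l n) {t : ℝ} (ht : 0 ≤ t) : c t ≤ c 0 := by
  refine le_initial_of_deriv_nonpos le_rfl ht (fun x hx => H.deriv_c x hx.1) (fun x hx => ?_)
  have hB : 0 < (1 + x) ^ p := Real.rpow_pos_of_pos (by linarith [hx.1]) _
  have := Real.rpow_nonneg (H.c_nonneg x hx.1) γ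
  have := mul_nonneg (mul_nonneg hB.le this) (H.g_nonneg x hx.1)
  linarith

lemma c_pos (H : ParScalars p γ L c g h l n) (hp0 : 0 ≤ p) (hp1 : p ≤ 1) (hγ : 1 ≤ γ)
    (hc0 : 0 < c 0) {t : ℝ} (ht : 0 ≤ t) : 0 < c t := by
  set K := L * c 0 ^ γ with hK
  have hK0 : 0 ≤ K := mul_nonneg H.L_nonneg (Real.rpow_nonneg hc0.le _)
  have key := initial_le_of_deriv_nonneg (a := 0) (T := t)
    (f := fun t => c t * Real.exp (K * (1 + t) ^ 2))
    (f' := fun t => -2 * ((1 + t) ^ p * c t ^ γ) * g t * Real.exp (K * (1 + t) ^ 2)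
      + c t * (Real.exp (K * (1 + t) ^ 2) * (K * (2 * (1 + t))))) le_rfl ht ?_ ?_
  · have h1 : 0 < c t * Real.exp (K * (1 + t) ^ 2) := lt_of_lt_of_le (by positivity) key
    exact pos_of_mul_pos_left h1 (Real.exp_pos _).le
  · intro x hx
    have ds : HasDerivWithinAt (fun t : ℝ => 1 + t) 1 (Set.Ici 0) x :=
      (hasDerivWithinAt_id x _).const_add 1
    refine ((H.deriv_c x hx.1).fun_mul (((ds.fun_pow 2).const_mul K).exp)).congr_deriv ?_
    push_cast
    ring
  · intro x hx
    obtain ⟨hB1, hB2⟩ := one_add_rpow_bounds hp0 hp1 hx.1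
    have hc := H.c_nonneg x hx.1
    have h1 : c x ^ γ ≤ c 0 ^ γ := Real.rpow_le_rpow hc (H.c_le hx.1) (by linarith)
    have h2 : (1 + x) ^ p * c x ^ γ * g x ≤ (1 + x) * c 0 ^ γ * (L * c x) := by
      have := Real.rpow_nonneg hc γ
      have := Real.rpow_nonneg hc0.le γ
      have := hx.1
      have := H.g_nonneg x hx.1
      have := H.g_le x hx.1
      gcongr
    have h3 : -2 * ((1 + x) ^ p * c x ^ γ) * g x * Real.exp (K * (1 + x) ^ 2)
      + c x * (Real.exp (K * (1 + x) ^ 2) * (K * (2 * (1 + x)))) =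
      2 * Real.exp (K * (1 + x) ^ 2) *
        ((1 + x) * c 0 ^ γ * (L * c x) - (1 + x) ^ p * c x ^ γ * g x) := by
      rw [hK]; ring
    rw [h3]
    exact mul_nonneg (by positivity) (by linarith)

lemma div_antitone (H : ParScalars p γ L c g h l n) (hp0 : 0 ≤ p) (hp1 : p ≤ 1) (hγ : 1 ≤ γ)
    (hc0 : 0 < c 0) {t T : ℝ} (ht : 0 ≤ t) (hT : t ≤ T) : g T / c T ≤ g t / c t := by
  refine le_initial_of_deriv_nonpos (f := fun t => g t / c t) ht hT (fun x hx =>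
    (H.deriv_g x (ht.trans hx.1)).fun_div (H.deriv_c x (ht.trans hx.1))
      (H.c_pos hp0 hp1 hγ hc0 (ht.trans hx.1)).ne') (fun x hx => ?_)
  have hx0 := ht.trans hx.1
  have hB : 0 < (1 + x) ^ p := Real.rpow_pos_of_pos (by linarith) _
  have hc := H.c_pos hp0 hp1 hγ hc0 hx0
  have hcγ : 0 < c x ^ γ := Real.rpow_pos_of_pos hc _
  refine div_nonpos_of_nonpos_of_nonneg ?_ (sq_nonneg _)
  have := mul_nonneg (mul_pos hB hcγ).le (sub_nonneg.2 (H.sq_le x hx0))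
  linarith

lemma hasDerivWithinAt_rpow_neg (H : ParScalars p γ L c g h l n) {t : ℝ} (ht : 0 ≤ t)
    (hc : 0 < c t) :
    HasDerivWithinAt (fun t => c t ^ (-γ)) (2 * γ * (1 + t) ^ p * (g t / c t)) (Set.Ici 0) t := by
  refine ((H.deriv_c t ht).rpow_of_pos (-γ) hc).congr_deriv ?_
  have hX : 0 < c t ^ (-γ) := Real.rpow_pos_of_pos hc _
  have hγ' : c t ^ γ = (c t ^ (-γ))⁻¹ := by rw [Real.rpow_neg hc.le, inv_inv]
  rw [hγ']
  field_simp

lemma div_mul_le (H : ParScalars p γ L c g h l n) (hp0 : 0 ≤ p) (hp1 : p ≤ 1) (hγ : 1 ≤ γ)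
    (hc0 : 0 < c 0) {t : ℝ} (ht : 0 ≤ t) :
    g t / c t * ((1 + t) ^ p * (1 + t)) ≤ (1 + g 0 / c 0 * c 0 ^ γ) * c t ^ (-γ) := by
  have hφ : ∀ x, 0 ≤ x → 0 ≤ g x / c x := fun x hx =>
    div_nonneg (H.g_nonneg x hx) (H.c_nonneg x hx)
  have key := initial_le_of_deriv_nonneg (a := 0) (T := t)
    (f := fun x => c x ^ (-γ) - g t / c t * ((1 + x) ^ p * (1 + x)))
    (f' := fun x => 2 * γ * (1 + x) ^ p * (g x / c x) - g t / c t * ((p + 1) * (1 + x) ^ p))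
    le_rfl ht ?_ ?_
  · have hc := H.c_pos hp0 hp1 hγ hc0 ht
    have h0 : 0 < c 0 ^ (-γ) := Real.rpow_pos_of_pos hc0 _
    have h0' : 0 < c 0 ^ γ := Real.rpow_pos_of_pos hc0 _
    have e0 : c 0 ^ γ * c 0 ^ (-γ) = 1 := by
      rw [← Real.rpow_add hc0]; simp
    simp only [add_zero, Real.one_rpow, mul_one] at key
    obtain ⟨hB1, hB2⟩ := one_add_rpow_bounds hp0 hp1 ht
    have hφt := hφ t ht
    have e1 : 0 ≤ g t / c t * ((1 + t) ^ p * (1 + t) - 1) := by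
      refine mul_nonneg hφt ?_
      nlinarith
    have e2 : c 0 ^ (-γ) ≤ c t ^ (-γ) := by linarith
    have e3 : g t / c t ≤ g 0 / c 0 := H.div_antitone hp0 hp1 hγ hc0 le_rfl ht
    have e4 : g 0 / c 0 * c 0 ^ γ * c 0 ^ (-γ) ≤ g 0 / c 0 * c 0 ^ γ * c t ^ (-γ) :=
      mul_le_mul_of_nonneg_left e2 (mul_nonneg (hφ 0 le_rfl) h0'.le)
    rw [mul_assoc, e0, mul_one] at e4
    linarith
  · intro x hx
    have hs : 0 < 1 + x := by linarith [hx.1]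
    have ds : HasDerivWithinAt (fun t : ℝ => 1 + t) 1 (Set.Ici 0) x :=
      (hasDerivWithinAt_id x _).const_add 1
    refine ((H.hasDerivWithinAt_rpow_neg hx.1 (H.c_pos hp0 hp1 hγ hc0 hx.1)).fun_sub
      (((hasDerivWithinAt_one_add_rpow p hx.1).fun_mul ds).const_mul (g t / c t))).congr_deriv ?_
    field_simp
  · intro x hx
    have hB : 0 < (1 + x) ^ p := Real.rpow_pos_of_pos (by linarith [hx.1]) _
    have e3 : g t / c t ≤ g x / c x := H.div_antitone hp0 hp1 hγ hc0 hx.1 hx.2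
    have : g t / c t * ((p + 1) * (1 + x) ^ p) ≤ g x / c x * (2 * γ * (1 + x) ^ p) := by
      have := hφ x hx.1
      gcongr
      linarith
    linarith

lemma rpow_neg_le (H : ParScalars p γ L c g h l n) (hp0 : 0 ≤ p) (hp1 : p ≤ 1) (hγ : 1 ≤ γ)
    (hc0 : 0 < c 0) {t : ℝ} (ht : 0 ≤ t) :
    c t ^ (-γ) ≤ (c 0 ^ (-γ) + 2 * γ * L) * ((1 + t) ^ p * (1 + t)) := by
  have key := le_initial_of_deriv_nonpos (a := 0) (T := t)
    (f := fun x => c x ^ (-γ) - 2 * γ * L * ((1 + x) ^ p * (1 + x)))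
    (f' := fun x => 2 * γ * (1 + x) ^ p * (g x / c x) - 2 * γ * L * ((p + 1) * (1 + x) ^ p))
    le_rfl ht ?_ ?_
  · have h0 : 0 < c 0 ^ (-γ) := Real.rpow_pos_of_pos hc0 _
    simp only [add_zero, Real.one_rpow, mul_one] at key
    obtain ⟨hB1, hB2⟩ := one_add_rpow_bounds hp0 hp1 ht
    have hL := H.L_nonneg
    have e1 : 0 ≤ c 0 ^ (-γ) * ((1 + t) ^ p * (1 + t) - 1) := by
      refine mul_nonneg h0.le ?_
      nlinarith
    have e2 : 0 ≤ 2 * γ * L := by positivity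
    linarith
  · intro x hx
    have hs : 0 < 1 + x := by linarith [hx.1]
    have ds : HasDerivWithinAt (fun t : ℝ => 1 + t) 1 (Set.Ici 0) x :=
      (hasDerivWithinAt_id x _).const_add 1
    refine ((H.hasDerivWithinAt_rpow_neg hx.1 (H.c_pos hp0 hp1 hγ hc0 hx.1)).fun_sub
      (((hasDerivWithinAt_one_add_rpow p hx.1).fun_mul ds).const_mul (2 * γ * L))).congr_deriv ?_
    field_simp
  · intro x hx
    have hB : 0 < (1 + x) ^ p := Real.rpow_pos_of_pos (by linarith [hx.1]) _
    have e1 : g x / c x ≤ L :=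
      div_le_of_le_mul₀ (H.c_nonneg x hx.1) H.L_nonneg (H.g_le x hx.1)
    have e2 : 2 * γ * (1 + x) ^ p * (g x / c x) ≤ 2 * γ * (1 + x) ^ p * L :=
      mul_le_mul_of_nonneg_left e1 (by positivity)
    have e3 : 0 ≤ 2 * γ * L * (p * (1 + x) ^ p) := by
      have := H.L_nonneg
      positivity
    linarith

/-- An antiderivative with bounded increments for the weighted squares of `u''`, where
`u' = -k A u` and `k = (1+t)^p c^γ`. -/
lemma exists_antideriv (H : ParScalars p γ L c g h l n) (hp0 : 0 ≤ p) (hp1 : p ≤ 1) (hγ : 1 ≤ γ)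
    (hc0 : 0 < c 0) : ∃ J J' : ℝ → ℝ, (∀ t, 0 ≤ t → J t ≤ 0) ∧
      (∀ t, 0 ≤ t → HasDerivWithinAt J (J' t) (Set.Ici 0) t) ∧
      ∀ t, 0 ≤ t → ∀ k k', k = (1 + t) ^ p * c t ^ γ →
        k' = k * (p / (1 + t) - 2 * γ * k * (g t / c t)) →
        (1 + t) ^ p * (2 * k' ^ 2 * c t + 2 * k ^ 4 * h t) * c t ^ (-γ) ≤ J' t ∧
        ((1 + t) ^ p) ^ 3 * (2 * k' ^ 2 * g t + 2 * k ^ 4 * l t) ≤ J' t := by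
  set C := 1 + g 0 / c 0 * c 0 ^ γ with hC
  have hC0 : 0 < C := by
    have := mul_nonneg (div_nonneg (H.g_nonneg 0 le_rfl) hc0.le) (Real.rpow_nonneg hc0.le γ)
    linarith
  set D := 1 + 2 * γ * C with hD
  have hD0 : 0 < D := by positivity
  set K := D ^ 2 + D ^ 2 * C + 8 * C with hK
  refine ⟨fun t => -(((1 + t) ^ p) ^ 3 * ((1 + t) ^ p * c t ^ γ) ^ 3 * h t)
      - 4 * (((1 + t) ^ p) ^ 2 * ((1 + t) ^ p * c t ^ γ) ^ 2 * g t) - K * n t,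
    fun t =>
      -((6 * p / (1 + t) - 6 * γ * ((1 + t) ^ p * c t ^ γ) * (g t / c t)) *
        (((1 + t) ^ p) ^ 3 * ((1 + t) ^ p * c t ^ γ) ^ 3 * h t))
      + 2 * (((1 + t) ^ p) ^ 3 * ((1 + t) ^ p * c t ^ γ) ^ 4 * l t)
      - 4 * ((4 * p / (1 + t) - 4 * γ * ((1 + t) ^ p * c t ^ γ) * (g t / c t)) *
        (((1 + t) ^ p) ^ 2 * ((1 + t) ^ p * c t ^ γ) ^ 2 * g t))
      + 8 * (((1 + t) ^ p) ^ 2 * ((1 + t) ^ p * c t ^ γ) ^ 3 * h t)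
      + 2 * K * (((1 + t) ^ p * c t ^ γ) * c t), ?_, ?_, ?_⟩
  · intro t ht
    have hB : 0 < (1 + t) ^ p := Real.rpow_pos_of_pos (by linarith) _
    have hcγ : 0 ≤ c t ^ γ := Real.rpow_nonneg (H.c_nonneg t ht) _
    have h1 := H.h_nonneg t ht
    have h2 := H.g_nonneg t ht
    have h3 := H.n_nonneg t ht
    have e1 : 0 ≤ ((1 + t) ^ p) ^ 3 * ((1 + t) ^ p * c t ^ γ) ^ 3 * h t := by positivity
    have e2 : 0 ≤ ((1 + t) ^ p) ^ 2 * ((1 + t) ^ p * c t ^ γ) ^ 2 * g t := by positivity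
    have e3 : 0 ≤ K * n t := by positivity
    linarith
  · intro t ht
    have hs : 0 < 1 + t := by linarith
    have hc := H.c_pos hp0 hp1 hγ hc0 ht
    have hB : 0 < (1 + t) ^ p := Real.rpow_pos_of_pos hs _
    have hcγ : 0 < c t ^ γ := Real.rpow_pos_of_pos hc _
    have dB := hasDerivWithinAt_one_add_rpow p ht
    have dk := dB.fun_mul ((H.deriv_c t ht).rpow_of_pos γ hc)
    have d1 := ((dB.fun_pow 3).fun_mul (dk.fun_pow 3)).fun_mul (H.deriv_h t ht)
    have d2 := ((dB.fun_pow 2).fun_mul (dk.fun_pow 2)).fun_mul (H.deriv_g t ht)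
    refine ((d1.fun_neg.fun_sub (d2.const_mul 4)).fun_sub ((H.deriv_n t ht).const_mul K)).congr_deriv
      ?_
    beta_reduce
    generalize (1 + t) ^ p = B at *
    generalize c t ^ γ = y at *
    push_cast
    field_simp
    ring
  · intro t ht k k' hk hk'
    have hs : 0 < 1 + t := by linarith
    obtain ⟨hB1, hB2⟩ := one_add_rpow_bounds hp0 hp1 ht
    have hc := H.c_pos hp0 hp1 hγ hc0 ht
    have hcγ : 0 < c t ^ γ := Real.rpow_pos_of_pos hc _
    have hX : 0 < c t ^ (-γ) := Real.rpow_pos_of_pos hc _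
    have hγ' : c t ^ γ = (c t ^ (-γ))⁻¹ := by rw [Real.rpow_neg hc.le, inv_inv]
    have hmain := H.div_mul_le hp0 hp1 hγ hc0 ht
    have hgn := H.g_nonneg t ht
    have hhn := H.h_nonneg t ht
    have hln := H.l_nonneg t ht
    have hφ : 0 ≤ g t / c t := div_nonneg hgn hc.le
    have hgφ : g t = g t / c t * c t := by field_simp
    rw [← hC] at hmain
    simp only [← hk]
    have hk0 : 0 < k := by rw [hk]; exact mul_pos (by linarith) hcγ
    have hkX : k * c t ^ (-γ) = (1 + t) ^ p := by rw [hk, hγ']; field_simp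
    rw [hgφ]
    have hcc : g t / c t * c t / c t = g t / c t := by field_simp
    rw [hcc]
    generalize g t / c t = φ at *
    generalize c t ^ (-γ) = X at *
    generalize (1 + t) ^ p = B at *
    generalize c t = c at *
    generalize h t = h at *
    generalize l t = l at *
    generalize 1 + t = s at *
    have hB0 : 0 < B := by linarith
    have hks : k * φ * s ≤ C := by
      have h1 : k * φ * s * B ≤ C * B := by
        calc k * φ * s * B = k * (φ * (B * s)) := by ring
          _ ≤ k * (C * X) := by gcongr
          _ = C * (k * X) := by ring
          _ = C * B := by rw [hkX]
      exact le_of_mul_le_mul_right h1 hB0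
    have hkφ : k * φ ≤ C / s := by rwa [le_div_iff₀ hs]
    have hk'2 : k' ^ 2 * s ^ 2 ≤ D ^ 2 * k ^ 2 := by
      have h1 : k' * s = k * (p - 2 * γ * (k * φ * s)) := by rw [hk']; field_simp
      have h2 : 0 ≤ k * φ * s := by positivity
      have h3 : |p - 2 * γ * (k * φ * s)| ≤ D := by
        have h4 : γ * (k * φ * s) ≤ γ * C := by gcongr
        have h5 : 0 ≤ γ * (k * φ * s) := by positivity
        rw [abs_le]; constructor <;> nlinarith
      have h4 : (p - 2 * γ * (k * φ * s)) ^ 2 ≤ D ^ 2 := sq_le_sq' (abs_le.1 h3).1 (abs_le.1 h3).2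
      calc k' ^ 2 * s ^ 2 = (k' * s) ^ 2 := by ring
        _ = (p - 2 * γ * (k * φ * s)) ^ 2 * k ^ 2 := by rw [h1]; ring
        _ ≤ D ^ 2 * k ^ 2 := by gcongr
    have hk'1 : k' ^ 2 ≤ D ^ 2 * k ^ 2 / s ^ 2 := by rwa [le_div_iff₀ (by positivity)]
    have hBs : B / s ≤ 1 := by rwa [div_le_one hs]
    have hBs0 : 0 ≤ B / s := by positivity
    have f1 : B * (2 * k' ^ 2 * c) * X ≤ 2 * D ^ 2 * (k * c) := by
      calc B * (2 * k' ^ 2 * c) * X ≤ B * (2 * (D ^ 2 * k ^ 2 / s ^ 2) * c) * X := by gcongr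
        _ = 2 * D ^ 2 * (k * c) * ((B / s ^ 2) * (k * X)) := by field_simp
        _ = 2 * D ^ 2 * (k * c) * (B / s) ^ 2 := by rw [hkX]; ring
        _ ≤ 2 * D ^ 2 * (k * c) * 1 ^ 2 := by gcongr
        _ = 2 * D ^ 2 * (k * c) := by ring
    have f2 : B * (2 * k ^ 4 * h) * X = 2 * (B ^ 2 * k ^ 3 * h) := by
      calc B * (2 * k ^ 4 * h) * X = 2 * B * k ^ 3 * h * (k * X) := by ring
        _ = _ := by rw [hkX]; ring
    have f3 : B ^ 3 * (2 * k' ^ 2 * (φ * c)) ≤ 2 * D ^ 2 * C * (k * c) := by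
      calc B ^ 3 * (2 * k' ^ 2 * (φ * c)) ≤ B ^ 3 * (2 * (D ^ 2 * k ^ 2 / s ^ 2) * (φ * c)) := by
            gcongr
        _ = 2 * D ^ 2 * (k * c) * (B ^ 3 / s ^ 2) * (k * φ) := by field_simp
        _ ≤ 2 * D ^ 2 * (k * c) * (B ^ 3 / s ^ 2) * (C / s) := by gcongr
        _ = 2 * D ^ 2 * C * (k * c) * (B / s) ^ 3 := by field_simp
        _ ≤ 2 * D ^ 2 * C * (k * c) * 1 ^ 3 := by gcongr
        _ = _ := by ring
    have f4 : (6 * p / s - 6 * γ * k * φ) * (B ^ 3 * k ^ 3 * h) ≤ 6 * (B ^ 2 * k ^ 3 * h) := by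
      calc (6 * p / s - 6 * γ * k * φ) * (B ^ 3 * k ^ 3 * h)
          ≤ (6 * 1 / s) * (B ^ 3 * k ^ 3 * h) := by
            have : 0 ≤ 6 * γ * k * φ := by positivity
            have h1 : 6 * p / s ≤ 6 * 1 / s := by gcongr
            gcongr
            linarith
        _ = 6 * (B ^ 2 * k ^ 3 * h) * (B / s) := by field_simp
        _ ≤ 6 * (B ^ 2 * k ^ 3 * h) * 1 := by gcongr
        _ = _ := by ring
    have f5 : (4 * p / s - 4 * γ * k * φ) * (B ^ 2 * k ^ 2 * (φ * c)) ≤ 4 * C * (k * c) := by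
      calc (4 * p / s - 4 * γ * k * φ) * (B ^ 2 * k ^ 2 * (φ * c))
          ≤ (4 * 1 / s) * (B ^ 2 * k ^ 2 * (φ * c)) := by
            have : 0 ≤ 4 * γ * k * φ := by positivity
            have h1 : 4 * p / s ≤ 4 * 1 / s := by gcongr
            gcongr
            linarith
        _ = 4 * (k * c) * (B ^ 2 / s) * (k * φ) := by field_simp
        _ ≤ 4 * (k * c) * (B ^ 2 / s) * (C / s) := by gcongr
        _ = 4 * C * (k * c) * (B / s) ^ 2 := by field_simp
        _ ≤ 4 * C * (k * c) * 1 ^ 2 := by gcongr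
        _ = _ := by ring
    have f6 : 2 * K * (k * c) = 2 * D ^ 2 * (k * c) + 2 * D ^ 2 * C * (k * c) + 16 * C * (k * c) := by
      rw [hK]; ring
    have p1 : 0 ≤ 2 * D ^ 2 * (k * c) := by positivity
    have p2 : 0 ≤ 2 * D ^ 2 * C * (k * c) := by positivity
    have p3 : 0 ≤ B ^ 2 * k ^ 3 * h := by positivity
    have p4 : 0 ≤ B ^ 3 * k ^ 4 * l := by positivity
    constructor
    · have : B * (2 * k' ^ 2 * c + 2 * k ^ 4 * h) * X =
          B * (2 * k' ^ 2 * c) * X + B * (2 * k ^ 4 * h) * X := by ring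
      linarith
    · have : B ^ 3 * (2 * k' ^ 2 * (φ * c) + 2 * k ^ 4 * l) =
          B ^ 3 * (2 * k' ^ 2 * (φ * c)) + 2 * (B ^ 3 * k ^ 4 * l) := by ring
      linarith

end ParScalars

lemma rpow_sub_rpow_mul_le {γ x y : ℝ} (hγ : 1 ≤ γ) (hx : 0 < x) (hy : 0 ≤ y) :
    (x ^ γ - y ^ γ) * x ≤ γ * x ^ γ * (x - y) := by
  have h1 : -1 ≤ (y - x) / x := by
    rw [le_div_iff₀ hx]; linarith
  have h2 := one_add_mul_self_le_rpow_one_add h1 hγ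
  have h3 : 1 + (y - x) / x = y / x := by field_simp; ring
  rw [h3, Real.div_rpow hy hx.le] at h2
  have hX : 0 < x ^ γ := Real.rpow_pos_of_pos hx _
  have h4 : (1 + γ * ((y - x) / x)) * (x ^ γ * x) ≤ y ^ γ / x ^ γ * (x ^ γ * x) := by gcongr
  have h5 : (1 + γ * ((y - x) / x)) * (x ^ γ * x) = x ^ γ * x + γ * x ^ γ * (y - x) := by
    field_simp
  have h6 : y ^ γ / x ^ γ * (x ^ γ * x) = y ^ γ * x := by field_simp
  linarith

lemma rpow_sub_rpow_mul_sub_nonneg {γ x y : ℝ} (hγ : 1 ≤ γ) (hx : 0 ≤ x) (hy : 0 ≤ y) :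
    0 ≤ (x ^ γ - y ^ γ) * (x - y) := by
  rcases le_total x y with h | h
  · exact mul_nonneg_of_nonpos_of_nonpos
      (sub_nonpos.2 (Real.rpow_le_rpow hx h (by linarith))) (sub_nonpos.2 h)
  · exact mul_nonneg (sub_nonneg.2 (Real.rpow_le_rpow hy h (by linarith))) (sub_nonneg.2 h)

lemma sq_rpow_sub_rpow_mul_le {γ x y : ℝ} (hγ : 1 ≤ γ) (hx : 0 < x) (hy : 0 ≤ y) (hxy : y ≤ x) :
    (x ^ γ - y ^ γ) ^ 2 * x ≤ γ * x ^ γ * ((x ^ γ - y ^ γ) * (x - y)) := by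
  have h1 := rpow_sub_rpow_mul_le hγ hx hy
  have h2 : 0 ≤ x ^ γ - y ^ γ := sub_nonneg.2 (Real.rpow_le_rpow hy hxy (by linarith))
  have := mul_le_mul_of_nonneg_left h1 h2
  linarith

lemma sq_rpow_sub_rpow_mul_add_le {γ x y : ℝ} (hγ : 1 ≤ γ) (hx : 0 < x) (hy : 0 < y) :
    (x ^ γ - y ^ γ) ^ 2 * (x ^ γ * x + y ^ γ * y) ≤
      γ * (x ^ γ + y ^ γ) ^ 2 * ((x ^ γ - y ^ γ) * (x - y)) := by
  wlog hxy : y ≤ x generalizing x y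
  · have := this hy hx (le_of_not_ge hxy)
    linarith
  have hX : 0 < x ^ γ := Real.rpow_pos_of_pos hx _
  have hY : 0 < y ^ γ := Real.rpow_pos_of_pos hy _
  have h0 := rpow_sub_rpow_mul_sub_nonneg hγ hx.le hy.le
  have h1 := sq_rpow_sub_rpow_mul_le hγ hx hy.le hxy
  calc (x ^ γ - y ^ γ) ^ 2 * (x ^ γ * x + y ^ γ * y)
      ≤ (x ^ γ - y ^ γ) ^ 2 * (x ^ γ * x + y ^ γ * x) := by gcongr
    _ = (x ^ γ + y ^ γ) * ((x ^ γ - y ^ γ) ^ 2 * x) := by ring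
    _ ≤ (x ^ γ + y ^ γ) * (γ * x ^ γ * ((x ^ γ - y ^ γ) * (x - y))) := by gcongr
    _ ≤ (x ^ γ + y ^ γ) * (γ * (x ^ γ + y ^ γ) * ((x ^ γ - y ^ γ) * (x - y))) := by
        gcongr; linarith
    _ = _ := by ring

lemma two_mul_abs_inner_le {H : Type*} [NormedAddCommGroup H] [InnerProductSpace ℝ H]
    (x y : H) {κ : ℝ} (hκ : 0 < κ) : 2 * |⟪x, y⟫| ≤ κ * ‖x‖ ^ 2 + κ⁻¹ * ‖y‖ ^ 2 := by
  have h1 := abs_real_inner_le_norm x y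
  have h2 : κ * ‖x‖ ^ 2 + κ⁻¹ * ‖y‖ ^ 2 - 2 * (‖x‖ * ‖y‖) = κ⁻¹ * (κ * ‖x‖ - ‖y‖) ^ 2 := by
    field_simp; ring
  have h3 : 0 ≤ κ⁻¹ * (κ * ‖x‖ - ‖y‖) ^ 2 := by positivity
  linarith

section Monotone

variable {H : Type*} [NormedAddCommGroup H] [InnerProductSpace ℝ H]
  (A : H →L[ℝ] H) (hA_sa : ∀ x y : H, ⟪A x, y⟫ = ⟪x, A y⟫) (hA_nn : ∀ x : H, 0 ≤ ⟪A x, x⟫)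

include hA_sa

lemma two_mul_inner_smul_sub_smul (x y : H) (η α : ℝ) :
    2 * ⟪η • A x - α • A y, x - y⟫ =
      (α + η) * ⟪A (x - y), x - y⟫ + (η - α) * (⟪A x, x⟫ - ⟪A y, y⟫) := by
  have h : ⟪A y, x⟫ = ⟪A x, y⟫ := by rw [hA_sa, real_inner_comm]
  simp only [map_sub, inner_sub_left, inner_sub_right, real_inner_smul_left, h]
  ring

include hA_nn

/-- Coercivity properties of the monotone operator `x ↦ ⟨Ax,x⟩^γ A x`. -/
lemma monotone_bounds {γ : ℝ} (hγ : 1 ≤ γ) (x y : H) :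
    0 ≤ ⟪(⟪A x, x⟫ ^ γ) • A x - (⟪A y, y⟫ ^ γ) • A y, x - y⟫ ∧
    ⟪A y, y⟫ ^ γ * ⟪A (x - y), x - y⟫ ≤
      2 * ⟪(⟪A x, x⟫ ^ γ) • A x - (⟪A y, y⟫ ^ γ) • A y, x - y⟫ ∧
    ⟪A x, x⟫ ^ γ * ⟪A (x - y), x - y⟫ ≤
      2 * ⟪(⟪A x, x⟫ ^ γ) • A x - (⟪A y, y⟫ ^ γ) • A y, x - y⟫ ∧
    (⟪A x, x⟫ ^ γ - ⟪A y, y⟫ ^ γ) * (⟪A x, x⟫ - ⟪A y, y⟫) ≤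
      2 * ⟪(⟪A x, x⟫ ^ γ) • A x - (⟪A y, y⟫ ^ γ) • A y, x - y⟫ := by
  rw [two_mul_inner_smul_sub_smul A hA_sa]
  have h := two_mul_inner_smul_sub_smul A hA_sa x y (⟪A x, x⟫ ^ γ) (⟪A y, y⟫ ^ γ)
  have h1 := rpow_sub_rpow_mul_sub_nonneg hγ (hA_nn x) (hA_nn y)
  have h2 := mul_nonneg (Real.rpow_nonneg (hA_nn x) γ) (hA_nn (x - y))
  have h3 := mul_nonneg (Real.rpow_nonneg (hA_nn y) γ) (hA_nn (x - y))
  refine ⟨?_, ?_, ?_, ?_⟩ <;> linarith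

lemma norm_sq_remainder_le {γ C β s : ℝ} (hγ : 1 ≤ γ) (hβ : 0 < β) (hβs : β ≤ s) (hC : 0 ≤ C)
    (x y : H) (hx : 0 < ⟪A x, x⟫) (hy : 0 < ⟪A y, y⟫)
    (hgx : ‖A x‖ ^ 2 / ⟪A x, x⟫ * (β * s) ≤ C * ⟪A x, x⟫ ^ (-γ))
    (hgy : ‖A y‖ ^ 2 / ⟪A y, y⟫ * (β * s) ≤ C * ⟪A y, y⟫ ^ (-γ)) :
    β ^ 2 * ‖(⟪A x, x⟫ ^ γ) • A x - (⟪A y, y⟫ ^ γ) • A y -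
        (2 / (⟪A y, y⟫ ^ (-γ) + ⟪A x, x⟫ ^ (-γ))) • A (x - y)‖ ^ 2 ≤
      4 * C * γ * ⟪(⟪A x, x⟫ ^ γ) • A x - (⟪A y, y⟫ ^ γ) • A y, x - y⟫ := by
  obtain ⟨h0, -, -, hD⟩ := monotone_bounds A hA_sa hA_nn hγ x y
  have hP := sq_rpow_sub_rpow_mul_add_le hγ hx hy
  have hX : 0 < ⟪A x, x⟫ ^ γ := Real.rpow_pos_of_pos hx _
  have hY : 0 < ⟪A y, y⟫ ^ γ := Real.rpow_pos_of_pos hy _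
  rw [Real.rpow_neg hx.le] at hgx ⊢
  rw [Real.rpow_neg hy.le] at hgy ⊢
  generalize ⟪(⟪A x, x⟫ ^ γ) • A x - (⟪A y, y⟫ ^ γ) • A y, x - y⟫ = D at *
  generalize ⟪A x, x⟫ ^ γ = η at *
  generalize ⟪A y, y⟫ ^ γ = α at *
  generalize ⟪A x, x⟫ = b at *
  generalize ⟪A y, y⟫ = c at *
  have hs : 0 < s := hβ.trans_le hβs
  have aux : ∀ g b η : ℝ, 0 ≤ g → 0 < b → 0 < η → g / b * (β * s) ≤ C * η⁻¹ →
      β ^ 2 * (η ^ 2 * g) ≤ C * (η * b) := by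
    intro g b η hg hb hη h
    have h1 : g * (β * s) * η ≤ C * b := by
      have := mul_le_mul_of_nonneg_right h (mul_pos hb hη).le
      have e1 : g / b * (β * s) * (b * η) = g * (β * s) * η := by field_simp
      have e2 : C * η⁻¹ * (b * η) = C * b := by field_simp
      linarith
    calc β ^ 2 * (η ^ 2 * g) = η * (g * (β * β) * η) := by ring
      _ ≤ η * (g * (β * s) * η) := by gcongr
      _ ≤ η * (C * b) := by gcongr
      _ = _ := by ring
  have ax := aux _ _ _ (sq_nonneg _) hx hX hgx
  have ay := aux _ _ _ (sq_nonneg _) hy hY hgy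
  have e : η • A x - α • A y - (2 / (α⁻¹ + η⁻¹)) • A (x - y) =
      ((η - α) / (α + η)) • (η • A x + α • A y) := by
    rw [map_sub]
    match_scalars <;> field_simp <;> ring
  have hn : ‖η • A x + α • A y‖ ^ 2 ≤ 2 * (η ^ 2 * ‖A x‖ ^ 2 + α ^ 2 * ‖A y‖ ^ 2) := by
    have h1 := parallelogram_law_with_norm ℝ (η • A x) (α • A y)
    have h2 : ‖η • A x‖ = η * ‖A x‖ := by rw [norm_smul, Real.norm_of_nonneg hX.le]
    have h3 : ‖α • A y‖ = α * ‖A y‖ := by rw [norm_smul, Real.norm_of_nonneg hY.le]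
    rw [h2, h3] at h1
    nlinarith [sq_nonneg ‖η • A x - α • A y‖]
  rw [e, norm_smul, mul_pow, Real.norm_eq_abs, sq_abs, div_pow]
  have hpos : 0 < (α + η) ^ 2 := by positivity
  calc β ^ 2 * ((η - α) ^ 2 / (α + η) ^ 2 * ‖η • A x + α • A y‖ ^ 2)
      ≤ β ^ 2 * ((η - α) ^ 2 / (α + η) ^ 2 * (2 * (η ^ 2 * ‖A x‖ ^ 2 + α ^ 2 * ‖A y‖ ^ 2))) := by
        gcongr
    _ = 2 * ((η - α) ^ 2 / (α + η) ^ 2) *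
        (β ^ 2 * (η ^ 2 * ‖A x‖ ^ 2) + β ^ 2 * (α ^ 2 * ‖A y‖ ^ 2)) := by ring
    _ ≤ 2 * ((η - α) ^ 2 / (α + η) ^ 2) * (C * (η * b) + C * (α * c)) := by gcongr
    _ = 2 * C * ((η - α) ^ 2 * (η * b + α * c)) / (α + η) ^ 2 := by ring
    _ ≤ 2 * C * (γ * (η + α) ^ 2 * ((η - α) * (b - c))) / (α + η) ^ 2 := by gcongr
    _ = 2 * C * γ * ((η - α) * (b - c)) := by field_simp; ring
    _ ≤ 2 * C * γ * (2 * D) := by gcongr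
    _ = _ := by ring

lemma norm_sq_smul_sub_smul_mul_le {γ C C' β s : ℝ} (hγ : 1 ≤ γ) (hβ : 0 < β) (hs : 0 < s)
    (hC : 0 ≤ C)  (hC' : 0 ≤ C')
    (x y : H) (hx : 0 < ⟪A x, x⟫) (hy : 0 < ⟪A y, y⟫)
    (hgx : ‖A x‖ ^ 2 / ⟪A x, x⟫ * (β * s) ≤ C * ⟪A x, x⟫ ^ (-γ))
    (hcy : ⟪A y, y⟫ ^ (-γ) ≤ C' * (β * s)) :
    ‖(⟪A x, x⟫ ^ γ) • A x - (⟪A y, y⟫ ^ γ) • A y‖ ^ 2 * ⟪A y, y⟫ ^ (-γ) ≤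
      (4 * ‖A‖ + 4 * γ * ‖A‖ + 4 * γ * C * C') *
        ⟪(⟪A x, x⟫ ^ γ) • A x - (⟪A y, y⟫ ^ γ) • A y, x - y⟫ := by
  obtain ⟨h0, hDα, hDη, hD⟩ := monotone_bounds A hA_sa hA_nn hγ x y
  have hX : 0 < ⟪A x, x⟫ ^ γ := Real.rpow_pos_of_pos hx _
  have hY : 0 < ⟪A y, y⟫ ^ γ := Real.rpow_pos_of_pos hy _
  have hE := norm_map_sq_le A hA_sa hA_nn (x - y)
  have hgL := norm_map_sq_le A hA_sa hA_nn y
  have hE0 := hA_nn (x - y)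
  have hle1 : ⟪A y, y⟫ ≤ ⟪A x, x⟫ → (⟪A x, x⟫ ^ γ - ⟪A y, y⟫ ^ γ) ^ 2 * ⟪A x, x⟫ ≤
      γ * ⟪A x, x⟫ ^ γ * ((⟪A x, x⟫ ^ γ - ⟪A y, y⟫ ^ γ) * (⟪A x, x⟫ - ⟪A y, y⟫)) :=
    sq_rpow_sub_rpow_mul_le hγ hx hy.le
  have hle2 : ⟪A x, x⟫ ≤ ⟪A y, y⟫ → (⟪A y, y⟫ ^ γ - ⟪A x, x⟫ ^ γ) ^ 2 * ⟪A y, y⟫ ≤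
      γ * ⟪A y, y⟫ ^ γ * ((⟪A y, y⟫ ^ γ - ⟪A x, x⟫ ^ γ) * (⟪A y, y⟫ - ⟪A x, x⟫)) :=
    sq_rpow_sub_rpow_mul_le hγ hy hx.le
  have hnn := rpow_sub_rpow_mul_sub_nonneg hγ hx.le hy.le
  have hmono : ⟪A x, x⟫ ≤ ⟪A y, y⟫ → ⟪A x, x⟫ ^ γ ≤ ⟪A y, y⟫ ^ γ := fun h =>
    Real.rpow_le_rpow hx.le h (by linarith)
  rw [Real.rpow_neg hx.le] at hgx
  rw [Real.rpow_neg hy.le] at hcy ⊢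
  generalize ⟪(⟪A x, x⟫ ^ γ) • A x - (⟪A y, y⟫ ^ γ) • A y, x - y⟫ = D at *
  generalize ⟪A x, x⟫ ^ γ = η at *
  generalize ⟪A y, y⟫ ^ γ = α at *
  generalize ⟪A x, x⟫ = b at *
  generalize ⟪A y, y⟫ = c at *
  generalize ⟪A (x - y), x - y⟫ = E at *
  have hL := norm_nonneg A
  have hn : ∀ κ δ : ℝ, ∀ z : H, ‖κ • A (x - y) + δ • A z‖ ^ 2 ≤
      2 * (κ ^ 2 * ‖A (x - y)‖ ^ 2 + δ ^ 2 * ‖A z‖ ^ 2) := by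
    intro κ δ z
    have h1 := parallelogram_law_with_norm ℝ (κ • A (x - y)) (δ • A z)
    have h2 : ‖κ • A (x - y)‖ ^ 2 = κ ^ 2 * ‖A (x - y)‖ ^ 2 := by
      rw [norm_smul, Real.norm_eq_abs, ← sq_abs κ]; ring
    have h3 : ‖δ • A z‖ ^ 2 = δ ^ 2 * ‖A z‖ ^ 2 := by
      rw [norm_smul, Real.norm_eq_abs, ← sq_abs δ]; ring
    rw [h2, h3] at h1
    nlinarith [sq_nonneg ‖κ • A (x - y) - δ • A z‖]
  rcases le_total c b with hcb | hbc
  · have e : η • A x - α • A y = α • A (x - y) + (η - α) • A x := by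
      rw [map_sub]; module
    have h2 := hle1 hcb
    have hg : η * ‖A x‖ ^ 2 * (β * s) ≤ C * b := by
      have := mul_le_mul_of_nonneg_right hgx (mul_pos hx hX).le
      have e1 : ‖A x‖ ^ 2 / b * (β * s) * (b * η) = η * ‖A x‖ ^ 2 * (β * s) := by field_simp
      have e2 : C * η⁻¹ * (b * η) = C * b := by field_simp
      linarith
    have h3 : (η - α) ^ 2 * ‖A x‖ ^ 2 * α⁻¹ ≤ 2 * γ * C * C' * D := by
      have h4 : (η - α) ^ 2 * ‖A x‖ ^ 2 * α⁻¹ * b ≤ 2 * γ * C * C' * D * b := by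
        calc (η - α) ^ 2 * ‖A x‖ ^ 2 * α⁻¹ * b
            = ((η - α) ^ 2 * b) * ‖A x‖ ^ 2 * α⁻¹ := by ring
          _ ≤ (γ * η * ((η - α) * (b - c))) * ‖A x‖ ^ 2 * (C' * (β * s)) := by gcongr
          _ ≤ (γ * η * (2 * D)) * ‖A x‖ ^ 2 * (C' * (β * s)) := by gcongr
          _ = 2 * γ * D * C' * (η * ‖A x‖ ^ 2 * (β * s)) := by ring
          _ ≤ 2 * γ * D * C' * (C * b) := by gcongr
          _ = _ := by ring
      exact le_of_mul_le_mul_right h4 hx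
    rw [e]
    calc ‖α • A (x - y) + (η - α) • A x‖ ^ 2 * α⁻¹
        ≤ 2 * (α ^ 2 * (‖A‖ * E) + (η - α) ^ 2 * ‖A x‖ ^ 2) * α⁻¹ := by
          gcongr
          exact (hn _ _ _).trans (by gcongr)
      _ = 2 * ‖A‖ * (α * E) + 2 * ((η - α) ^ 2 * ‖A x‖ ^ 2 * α⁻¹) := by field_simp
      _ ≤ 2 * ‖A‖ * (2 * D) + 2 * (2 * γ * C * C' * D) := by gcongr
      _ ≤ _ := by
        have : 0 ≤ 4 * γ * ‖A‖ * D := by positivity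
        linarith
  · have e : η • A x - α • A y = η • A (x - y) + (η - α) • A y := by
      rw [map_sub]; module
    have h2 := hle2 hbc
    have hηα := hmono hbc
    have h3 : (η - α) ^ 2 * (‖A‖ * c) * α⁻¹ ≤ 2 * γ * ‖A‖ * D := by
      calc (η - α) ^ 2 * (‖A‖ * c) * α⁻¹ = ((α - η) ^ 2 * c) * ‖A‖ * α⁻¹ := by ring
        _ ≤ (γ * α * ((α - η) * (c - b))) * ‖A‖ * α⁻¹ := by gcongr
        _ = γ * ((η - α) * (b - c)) * ‖A‖ := by field_simp; ring
        _ ≤ γ * (2 * D) * ‖A‖ := by gcongr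
        _ = _ := by ring
    rw [e]
    calc ‖η • A (x - y) + (η - α) • A y‖ ^ 2 * α⁻¹
        ≤ 2 * (η ^ 2 * (‖A‖ * E) + (η - α) ^ 2 * (‖A‖ * c)) * α⁻¹ := by
          gcongr
          exact (hn _ _ _).trans (by gcongr)
      _ = 2 * ‖A‖ * (η * E) * (η * α⁻¹) + 2 * ((η - α) ^ 2 * (‖A‖ * c) * α⁻¹) := by ring
      _ ≤ 2 * ‖A‖ * (2 * D) * 1 + 2 * (2 * γ * ‖A‖ * D) := by
          have : η * α⁻¹ ≤ 1 := by rw [← div_eq_mul_inv]; exact (div_le_one hY).2 hηα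
          gcongr
      _ ≤ _ := by
        have : 0 ≤ 4 * γ * C * C' * D := by positivity
        linarith

end Monotone

section Energy

variable {H : Type*} [NormedAddCommGroup H] [InnerProductSpace ℝ H]
  (A : H →L[ℝ] H) (hA_sa : ∀ x y : H, ⟪A x, y⟫ = ⟪x, A y⟫) (hA_nn : ∀ x : H, 0 ≤ ⟪A x, x⟫)

/-- The weighted energy of the difference `ρ` of two solutions, `q` being the derivative of the
difference without its initial layer, and `lam` a coefficient comparable to those of the
equations. -/
noncomputable def energy (p ε : ℝ) (ρ q : ℝ → H) (lam : ℝ → ℝ) (t : ℝ) : ℝ :=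
  ‖ρ t‖ ^ 2 * (1 / 2 - ε * p / 2 * ((1 + t) ^ p / (1 + t))) + ε * ((1 + t) ^ p * ⟪q t, ρ t⟫) +
    8 * (((1 + t) ^ p) ^ 2 * (ε ^ 2 * ‖q t‖ ^ 2 + ε * (lam t * ⟪A (ρ t), ρ t⟫)))

lemma le_energy {p ε t : ℝ} {ρ q : ℝ → H} {lam : ℝ → ℝ} (hp0 : 0 ≤ p) (hp1 : p ≤ 1)
    (hε : 0 < ε) (hε' : ε ≤ 1 / 4) (ht : 0 ≤ t) (hlam : 0 ≤ lam t)
    (hE : 0 ≤ ⟪A (ρ t), ρ t⟫) : ‖ρ t‖ ^ 2 / 4 ≤ energy A p ε ρ q lam t := by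
  obtain ⟨hB1, hB2⟩ := one_add_rpow_bounds hp0 hp1 ht
  unfold energy
  have h1 := two_mul_abs_inner_le (q t) (ρ t) (κ := 4 * ε * (1 + t) ^ p) (by positivity)
  have h1' : 2 * (ε * (1 + t) ^ p) * |⟪q t, ρ t⟫| ≤
      4 * ε ^ 2 * ((1 + t) ^ p) ^ 2 * ‖q t‖ ^ 2 + ‖ρ t‖ ^ 2 / 4 := by
    have := mul_le_mul_of_nonneg_left h1 (by positivity : 0 ≤ ε * (1 + t) ^ p)
    have e : ε * (1 + t) ^ p * ((4 * ε * (1 + t) ^ p)⁻¹ * ‖ρ t‖ ^ 2) = ‖ρ t‖ ^ 2 / 4 := by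
      field_simp
    linarith
  have h2 : -(ε * (1 + t) ^ p * |⟪q t, ρ t⟫|) ≤ ε * ((1 + t) ^ p * ⟪q t, ρ t⟫) := by
    have := mul_le_mul_of_nonneg_left (neg_abs_le ⟪q t, ρ t⟫) (by positivity : 0 ≤ ε * (1 + t) ^ p)
    linarith
  have h3 : (1 + t) ^ p / (1 + t) ≤ 1 := (div_le_one (by linarith)).2 hB2
  have h4 : ε * p / 2 * ((1 + t) ^ p / (1 + t)) ≤ 1 / 4 * 1 / 2 * 1 := by gcongr
  have h5 : ‖ρ t‖ ^ 2 * (3 / 8) ≤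
      ‖ρ t‖ ^ 2 * (1 / 2 - ε * p / 2 * ((1 + t) ^ p / (1 + t))) := by
    gcongr; linarith
  have h6 : 0 ≤ ((1 + t) ^ p) ^ 2 * (ε * (lam t * ⟪A (ρ t), ρ t⟫)) := by positivity
  have h7 : 0 ≤ ((1 + t) ^ p) ^ 2 * (ε ^ 2 * ‖q t‖ ^ 2) := by positivity
  linarith

include hA_sa in
lemma hasDerivWithinAt_energy {p ε lam' t : ℝ} {ρ q : ℝ → H} {lam : ℝ → ℝ} {q' ϑ F Q : H}
    (ht : 0 ≤ t) (hρ : HasDerivWithinAt ρ (q t + ϑ) (Set.Ici 0) t)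
    (hq : HasDerivWithinAt q q' (Set.Ici 0) t)
    (hlam : HasDerivWithinAt lam lam' (Set.Ici 0) t)
    (heq : ε • q' = -(((1 + t) ^ p)⁻¹ • q t + F + ε • Q)) :
    HasDerivWithinAt (energy A p ε ρ q lam)
      (⟪ϑ, ρ t⟫ * (1 - ε * p * ((1 + t) ^ p / (1 + t)))
        + ε / 2 * (p * (1 - p) * ((1 + t) ^ p / (1 + t) ^ 2)) * ‖ρ t‖ ^ 2
        - (1 + t) ^ p * ⟪F, ρ t⟫ - ε * ((1 + t) ^ p * ⟪Q, ρ t⟫) + ε * ((1 + t) ^ p * ‖q t‖ ^ 2)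
        + ε * ((1 + t) ^ p * ⟪q t, ϑ⟫)
        + 16 * (p * ((1 + t) ^ p) ^ 2 / (1 + t) *
            (ε ^ 2 * ‖q t‖ ^ 2 + ε * (lam t * ⟪A (ρ t), ρ t⟫))
          + ε / 2 * (((1 + t) ^ p) ^ 2 * (lam' * ⟪A (ρ t), ρ t⟫))
          - ε * ((1 + t) ^ p * ‖q t‖ ^ 2)
          - ε * (((1 + t) ^ p) ^ 2 * ⟪F - lam t • A (ρ t), q t⟫)
          - ε ^ 2 * (((1 + t) ^ p) ^ 2 * ⟪Q, q t⟫)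
          + ε * (((1 + t) ^ p) ^ 2 * (lam t * ⟪A (ρ t), ϑ⟫)))) (Set.Ici 0) t := by
  have hs : 0 < 1 + t := by linarith
  have hB : 0 < (1 + t) ^ p := Real.rpow_pos_of_pos hs _
  have dB := hasDerivWithinAt_one_add_rpow p ht
  have ds : HasDerivWithinAt (fun t : ℝ => 1 + t) 1 (Set.Ici 0) t :=
    (hasDerivWithinAt_id t _).const_add 1
  have dBs : HasDerivWithinAt (fun t : ℝ => (1 + t) ^ p / (1 + t))
      (-((1 - p) * ((1 + t) ^ p / (1 + t) ^ 2))) (Set.Ici 0) t := by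
    refine (dB.fun_div ds hs.ne').congr_deriv ?_
    field_simp
    ring
  have dAρ := A.hasFDerivAt.comp_hasDerivWithinAt t hρ
  have d1 := hρ.norm_sq.fun_mul
    ((dBs.const_mul (ε * p / 2)).const_sub (1 / 2))
  have d2 := (dB.fun_mul (hq.inner ℝ hρ)).const_mul ε
  have d3 := ((dB.fun_pow 2).fun_mul ((hq.norm_sq.const_mul (ε ^ 2)).fun_add
    ((hlam.fun_mul (dAρ.inner ℝ hρ)).const_mul ε))).const_mul 8
  have i1 : ε * ⟪q', ρ t⟫ = -(((1 + t) ^ p)⁻¹ * ⟪q t, ρ t⟫ + ⟪F, ρ t⟫ + ε * ⟪Q, ρ t⟫) := by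
    rw [← real_inner_smul_left, heq]
    simp only [inner_neg_left, inner_add_left, real_inner_smul_left]
  have i2 : ε * ⟪q t, q'⟫ = -(((1 + t) ^ p)⁻¹ * ‖q t‖ ^ 2 + ⟪F, q t⟫ + ε * ⟪Q, q t⟫) := by
    rw [real_inner_comm, ← real_inner_smul_left, heq]
    simp only [inner_neg_left, inner_add_left, real_inner_smul_left, real_inner_self_eq_norm_sq]
  have i3 : ⟪A ϑ, ρ t⟫ = ⟪A (ρ t), ϑ⟫ := by rw [hA_sa, real_inner_comm]
  have i4 : ⟪A (q t), ρ t⟫ = ⟪A (ρ t), q t⟫ := by rw [hA_sa, real_inner_comm]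
  have i5 : ⟪q t, ρ t⟫ = ⟪ρ t, q t⟫ := real_inner_comm _ _
  have i6 : ⟪ϑ, ρ t⟫ = ⟪ρ t, ϑ⟫ := real_inner_comm _ _
  refine ((d1.fun_add d2).fun_add d3).congr_deriv ?_
  simp only [Function.comp_apply, map_add, inner_add_left, inner_add_right, inner_sub_left,
    real_inner_smul_left, i3, i4, real_inner_self_eq_norm_sq]
  rw [i5] at i1 ⊢
  rw [i6]
  have hBi : (1 + t) ^ p * ((1 + t) ^ p)⁻¹ = 1 := mul_inv_cancel₀ hB.ne'
  push_cast
  linear_combination (1 + t) ^ p * i1 + 16 * ((1 + t) ^ p) ^ 2 * ε * i2 -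
    (⟪ρ t, q t⟫ + 16 * (1 + t) ^ p * ε * ‖q t‖ ^ 2) * hBi

include hA_sa hA_nn in
lemma energy_rate_le {p ε β s D lam lam' S M C γ a X : ℝ} {ρ q ϑ F v : H}
    (hp0 : 0 ≤ p) (hp1 : p ≤ 1) (hε : 0 < ε) (hε' : ε ≤ 1 / 4) (hβ : 1 ≤ β) (hβs : β ≤ s)
    (hD0 : 0 ≤ D) (hM : 0 ≤ M) (hγ : 0 ≤ γ)
    (hX : 0 < X) (hXE : ⟪A ρ, ρ⟫ ≤ 2 * D * X) (hlam0 : 0 ≤ lam) (hlamE : lam * ⟪A ρ, ρ⟫ ≤ 4 * D)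
    (hlam' : lam' ≤ 2 * γ * M / s * lam) (hlama : lam ≤ 2 * a)
    (hR : β ^ 2 * ‖F - lam • A ρ‖ ^ 2 ≤ C * D) (hS : ‖ρ‖ ≤ S)
    (hεC : 16 * ε * (4 + 4 * γ * M + C) ≤ 1 / 4) :
    ⟪ϑ, ρ⟫ * (1 - ε * p * (β / s))
        + ε / 2 * (p * (1 - p) * (β / s ^ 2)) * ‖ρ‖ ^ 2
        - β * D - ε * (β * ⟪A v, ρ⟫) + ε * (β * ‖q‖ ^ 2)
        + ε * (β * ⟪q, ϑ⟫)
        + 16 * (p * β ^ 2 / s * (ε ^ 2 * ‖q‖ ^ 2 + ε * (lam * ⟪A ρ, ρ⟫))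
          + ε / 2 * (β ^ 2 * (lam' * ⟪A ρ, ρ⟫))
          - ε * (β * ‖q‖ ^ 2)
          - ε * (β ^ 2 * ⟪F - lam • A ρ, q⟫)
          - ε ^ 2 * (β ^ 2 * ⟪A v, q⟫)
          + ε * (β ^ 2 * (lam * ⟪A ρ, ϑ⟫))) ≤
      -(β * D / 2) + (1 + 8 * ‖A‖ * a) * S * (β ^ 2 * ‖ϑ‖)
        + ε / 2 * (p * (1 - p) * (β / s ^ 2)) * S ^ 2 + ε * (β * ‖ϑ‖ ^ 2)
        + ε ^ 2 * (2 * (β * ⟪A v, v⟫ * X) + 4 * (β ^ 3 * ‖A v‖ ^ 2)) := by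
  have hs : 0 < s := by linarith
  have hE := hA_nn ρ
  have hV := hA_nn v
  have hL := norm_nonneg A
  have hS0 : 0 ≤ S := (norm_nonneg _).trans hS
  have hβs1 : β / s ≤ 1 := (div_le_one hs).2 hβs
  have hβs0 : 0 ≤ β / s := by positivity
  have t1 : ⟪ϑ, ρ⟫ * (1 - ε * p * (β / s)) ≤ S * (β ^ 2 * ‖ϑ‖) := by
    have h1 : ⟪ϑ, ρ⟫ ≤ ‖ϑ‖ * S := (real_inner_le_norm _ _).trans (by gcongr)
    have h2 : ε * p * (β / s) ≤ 1 / 4 * 1 * 1 := by gcongr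
    have h2' : 0 ≤ ε * p * (β / s) := by positivity
    calc ⟪ϑ, ρ⟫ * (1 - ε * p * (β / s)) ≤ ‖ϑ‖ * S * (1 - ε * p * (β / s)) := by
          apply mul_le_mul_of_nonneg_right h1; linarith
      _ ≤ ‖ϑ‖ * S * 1 := by gcongr; linarith
      _ ≤ ‖ϑ‖ * S * β ^ 2 := by gcongr; nlinarith
      _ = _ := by ring
  have t2 : ε / 2 * (p * (1 - p) * (β / s ^ 2)) * ‖ρ‖ ^ 2 ≤
      ε / 2 * (p * (1 - p) * (β / s ^ 2)) * S ^ 2 := by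
    have : 0 ≤ 1 - p := by linarith
    gcongr
  have t3 : -(ε * (β * ⟪A v, ρ⟫)) ≤ β * D / 4 + ε ^ 2 * (2 * (β * ⟪A v, v⟫ * X)) := by
    have h1 := inner_map_sq_le A hA_sa hA_nn v ρ
    have h2 : |ε * ⟪A v, ρ⟫| ≤ D / 4 + ε ^ 2 * (2 * (⟪A v, v⟫ * X)) := by
      apply abs_le_of_sq_le_sq _ (by positivity)
      calc (ε * ⟪A v, ρ⟫) ^ 2 = ε ^ 2 * ⟪A v, ρ⟫ ^ 2 := by ring
        _ ≤ ε ^ 2 * (⟪A v, v⟫ * (2 * D * X)) := by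
          gcongr
          exact h1.trans (by gcongr)
        _ ≤ (D / 4 + ε ^ 2 * (2 * (⟪A v, v⟫ * X))) ^ 2 := by
          nlinarith [sq_nonneg (D / 4 - ε ^ 2 * (2 * (⟪A v, v⟫ * X)))]
    have h3 := (neg_abs_le (ε * ⟪A v, ρ⟫))
    have := mul_le_mul_of_nonneg_left (neg_le.1 (h3.trans' (neg_le_neg h2)))
      (by linarith : 0 ≤ β)
    linarith
  have t4 : ε * (β * ⟪q, ϑ⟫) ≤ ε * (β * ‖q‖ ^ 2) + ε * (β * ‖ϑ‖ ^ 2) := by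
    have h1 := two_mul_abs_inner_le q ϑ (κ := 1) one_pos
    have h2 : ⟪q, ϑ⟫ ≤ ‖q‖ ^ 2 + ‖ϑ‖ ^ 2 := by
      have := le_abs_self ⟪q, ϑ⟫
      have := abs_nonneg ⟪q, ϑ⟫
      norm_num at h1
      linarith
    have := mul_le_mul_of_nonneg_left h2 (by positivity : 0 ≤ ε * β)
    linarith
  have t5 : p * β ^ 2 / s * (ε ^ 2 * ‖q‖ ^ 2 + ε * (lam * ⟪A ρ, ρ⟫)) ≤
      ε * (β * ‖q‖ ^ 2) / 4 + ε * (β * (4 * D)) := by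
    calc p * β ^ 2 / s * (ε ^ 2 * ‖q‖ ^ 2 + ε * (lam * ⟪A ρ, ρ⟫))
        = p * β * (β / s) * (ε * (ε * ‖q‖ ^ 2) + ε * (lam * ⟪A ρ, ρ⟫)) := by ring
      _ ≤ 1 * β * 1 * (ε * (1 / 4 * ‖q‖ ^ 2) + ε * (4 * D)) := by gcongr
      _ = _ := by ring
  have t6 : ε / 2 * (β ^ 2 * (lam' * ⟪A ρ, ρ⟫)) ≤ ε * (β * D) * (4 * γ * M) := by
    calc ε / 2 * (β ^ 2 * (lam' * ⟪A ρ, ρ⟫))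
        ≤ ε / 2 * (β ^ 2 * (2 * γ * M / s * lam * ⟪A ρ, ρ⟫)) := by gcongr
      _ = ε / 2 * (β * (β / s) * (2 * γ * M * (lam * ⟪A ρ, ρ⟫))) := by ring
      _ ≤ ε / 2 * (β * 1 * (2 * γ * M * (4 * D))) := by gcongr
      _ = _ := by ring
  have t7 : -(ε * (β ^ 2 * ⟪F - lam • A ρ, q⟫)) ≤ ε * (β * ‖q‖ ^ 2) / 4 + ε * (β * D) * C := by
    have h1 := two_mul_abs_inner_le (F - lam • A ρ) q (κ := 2 * β) (by positivity)
    have h2 : -(ε * (β ^ 2 * ⟪F - lam • A ρ, q⟫)) ≤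
        ε * β * (β ^ 2 * ‖F - lam • A ρ‖ ^ 2) + ε * (β * ‖q‖ ^ 2) / 4 := by
      have h3 := neg_abs_le ⟪F - lam • A ρ, q⟫
      have h4 : -⟪F - lam • A ρ, q⟫ ≤ β * ‖F - lam • A ρ‖ ^ 2 + (2 * β)⁻¹ * ‖q‖ ^ 2 / 2 := by
        linarith
      have h5 := mul_le_mul_of_nonneg_left h4 (by positivity : 0 ≤ ε * β ^ 2)
      have e : ε * β ^ 2 * ((2 * β)⁻¹ * ‖q‖ ^ 2 / 2) = ε * (β * ‖q‖ ^ 2) / 4 := by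
        field_simp; ring
      linarith
    have := mul_le_mul_of_nonneg_left hR (by positivity : 0 ≤ ε * β)
    linarith
  have t8 : -(ε ^ 2 * (β ^ 2 * ⟪A v, q⟫)) ≤
      ε * (β * ‖q‖ ^ 2) / 4 + ε ^ 2 * (β ^ 3 * ‖A v‖ ^ 2) / 4 := by
    have h1 := two_mul_abs_inner_le (A v) q (κ := 2 * ε * β) (by positivity)
    have h3 := neg_abs_le ⟪A v, q⟫
    have h4 : -⟪A v, q⟫ ≤ ε * β * ‖A v‖ ^ 2 + (2 * ε * β)⁻¹ * ‖q‖ ^ 2 / 2 := by linarith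
    have h5 := mul_le_mul_of_nonneg_left h4 (by positivity : 0 ≤ ε ^ 2 * β ^ 2)
    have e : ε ^ 2 * β ^ 2 * ((2 * ε * β)⁻¹ * ‖q‖ ^ 2 / 2) = ε * (β * ‖q‖ ^ 2) / 4 := by
      field_simp; ring
    have h6 : ε * (ε ^ 2 * (β ^ 3 * ‖A v‖ ^ 2)) ≤ 1 / 4 * (ε ^ 2 * (β ^ 3 * ‖A v‖ ^ 2)) := by
      gcongr
    linarith
  have t9 : ε * (β ^ 2 * (lam * ⟪A ρ, ϑ⟫)) ≤ 8 * ‖A‖ * a * S * (β ^ 2 * ‖ϑ‖) / 16 := by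
    have h1 : ⟪A ρ, ϑ⟫ ≤ ‖A‖ * S * ‖ϑ‖ :=
      (real_inner_le_norm _ _).trans (by gcongr; exact (A.le_opNorm _).trans (by gcongr))
    calc ε * (β ^ 2 * (lam * ⟪A ρ, ϑ⟫)) ≤ ε * (β ^ 2 * (lam * (‖A‖ * S * ‖ϑ‖))) := by gcongr
      _ ≤ 1 / 4 * (β ^ 2 * (2 * a * (‖A‖ * S * ‖ϑ‖))) := by gcongr
      _ = _ := by ring
  have t10 := mul_le_mul_of_nonneg_right hεC (by positivity : 0 ≤ β * D)
  have t11 : 0 ≤ ε * (β * ‖q‖ ^ 2) := by positivity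
  linarith

end Energy

section Layer

variable {H : Type*} [NormedAddCommGroup H] [InnerProductSpace ℝ H]

lemma hasDerivWithinAt_weighted_norm_sq {ε B X' t : ℝ} {q : ℝ → H} {X : ℝ → ℝ} {q' F Q : H}
    (hq : HasDerivWithinAt q q' (Set.Ici 0) t) (hX : HasDerivWithinAt X X' (Set.Ici 0) t)
    (heq : ε • q' = -(B⁻¹ • q t + F + ε • Q)) :
    HasDerivWithinAt (fun t => ε * (‖q t‖ ^ 2 * X t))
      (-(2 * X t * (B⁻¹ * ‖q t‖ ^ 2 + ⟪F, q t⟫ + ε * ⟪Q, q t⟫)) + ε * (‖q t‖ ^ 2 * X'))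
      (Set.Ici 0) t := by
  have i2 : ε * ⟪q t, q'⟫ = -(B⁻¹ * ‖q t‖ ^ 2 + ⟪F, q t⟫ + ε * ⟪Q, q t⟫) := by
    rw [real_inner_comm, ← real_inner_smul_left, heq]
    simp only [inner_neg_left, inner_add_left, real_inner_smul_left, real_inner_self_eq_norm_sq]
  refine ((hq.norm_sq.fun_mul hX).const_mul ε).congr_deriv ?_
  linear_combination 2 * X t * i2

lemma weighted_norm_sq_rate_le {ε β s X X' φ γ C K D G : ℝ} {q F Q : H}
    (hε : 0 < ε) (hβ : 0 < β) (hβs : β ≤ s) (hX : 0 < X)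
    (hγ : 0 ≤ γ) (hX' : X' = 2 * γ * β * φ) (hφ : φ * (β * s) ≤ C * X)
    (hF : ‖F‖ ^ 2 * X ≤ K * D) (hQ : ‖Q‖ ^ 2 ≤ G) (hεC : 2 * γ * C * ε ≤ 1 / 2) :
    -(2 * X * (β⁻¹ * ‖q‖ ^ 2 + ⟪F, q⟫ + ε * ⟪Q, q⟫)) + ε * (‖q‖ ^ 2 * X') ≤
      -(‖q‖ ^ 2 * X * β⁻¹) + 4 * K * (β * D) + ε ^ 2 * (4 * (β * G * X)) := by
  have hs : 0 < s := hβ.trans_le hβs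
  have h1 : ∀ Y : H, -(2 * ⟪Y, q⟫) ≤ 4 * β * ‖Y‖ ^ 2 + β⁻¹ * ‖q‖ ^ 2 / 4 := by
    intro Y
    have h := two_mul_abs_inner_le Y q (κ := 4 * β) (by positivity)
    have := neg_abs_le ⟪Y, q⟫
    have e : (4 * β)⁻¹ * ‖q‖ ^ 2 = β⁻¹ * ‖q‖ ^ 2 / 4 := by field_simp
    linarith
  have h2 := mul_le_mul_of_nonneg_left (h1 F) hX.le
  have h3 := mul_le_mul_of_nonneg_left (h1 (ε • Q)) hX.le
  rw [real_inner_smul_left, norm_smul, Real.norm_of_nonneg hε.le, mul_pow] at h3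
  have h4 : ε * (‖q‖ ^ 2 * X') ≤ ‖q‖ ^ 2 * X * β⁻¹ / 2 := by
    have e : β * φ ≤ C * X / s := by rw [le_div_iff₀ hs]; linarith
    calc ε * (‖q‖ ^ 2 * X') = 2 * γ * ε * (‖q‖ ^ 2 * (β * φ)) := by rw [hX']; ring
      _ ≤ 2 * γ * ε * (‖q‖ ^ 2 * (C * X / s)) := by gcongr
      _ = (2 * γ * C * ε) * (‖q‖ ^ 2 * X * s⁻¹) := by ring
      _ ≤ 1 / 2 * (‖q‖ ^ 2 * X * β⁻¹) := by gcongr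
      _ = _ := by ring
  have h5 : 4 * β * X * ‖F‖ ^ 2 ≤ 4 * K * (β * D) := by
    have := mul_le_mul_of_nonneg_left hF (by positivity : 0 ≤ 4 * β)
    linarith
  have h6 : ε ^ 2 * (4 * (β * ‖Q‖ ^ 2 * X)) ≤ ε ^ 2 * (4 * (β * G * X)) := by gcongr
  linarith

lemma IsCorrector.norm_le {p ε : ℝ} {w₀ : H} {θ θ' θ'' : ℝ → H}
    (hθ : IsCorrector p ε w₀ θ θ' θ'') (hp0 : 0 ≤ p) (hp1 : p ≤ 1) (hε : 0 < ε) {t : ℝ}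
    (ht : 0 ≤ t) : ‖θ' t‖ ≤ ‖w₀‖ * (1 + t) ^ (-(1 / ε)) := by
  obtain ⟨-, h0, -, hd, he⟩ := hθ
  have key := le_initial_of_deriv_nonpos (a := 0) (T := t)
    (f := fun t => ‖θ' t‖ ^ 2 * (1 + t) ^ (2 / ε))
    (f' := fun t => (2 * ⟪θ' t, θ'' t⟫) * (1 + t) ^ (2 / ε)
      + ‖θ' t‖ ^ 2 * (2 / ε * (1 + t) ^ (2 / ε) / (1 + t))) le_rfl ht ?_ ?_
  · simp only [h0, add_zero, Real.one_rpow, mul_one] at key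
    have hs : 0 < 1 + t := by linarith
    apply abs_le_of_sq_le_sq' _ (by positivity) |>.2
    rw [mul_pow, ← Real.rpow_natCast ((1 + t) ^ (-(1 / ε))), ← Real.rpow_mul hs.le]
    have e : -(1 / ε) * ((2 : ℕ) : ℝ) = -(2 / ε) := by push_cast; ring
    rw [e, Real.rpow_neg hs.le, ← div_eq_mul_inv, le_div_iff₀ (Real.rpow_pos_of_pos hs _)]
    exact key
  · intro x hx
    exact (hd x hx.1).norm_sq.fun_mul (hasDerivWithinAt_one_add_rpow (2 / ε) hx.1)
  · intro x hx
    have hs : 0 < 1 + x := by linarith [hx.1]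
    obtain ⟨hB1, hB2⟩ := one_add_rpow_bounds hp0 hp1 hx.1
    have h1 := congrArg (fun z => ⟪θ' x, z⟫) (he x hx.1)
    simp only [inner_add_right, real_inner_smul_right, real_inner_self_eq_norm_sq,
      inner_zero_right, Real.rpow_neg hs.le] at h1
    have h2 : ⟪θ' x, θ'' x⟫ = -(((1 + x) ^ p)⁻¹ * ‖θ' x‖ ^ 2) / ε := by
      field_simp at h1 ⊢
      linarith
    rw [h2]
    have h3 : (1 + x)⁻¹ ≤ ((1 + x) ^ p)⁻¹ := by gcongr
    have e : 2 * (-(((1 + x) ^ p)⁻¹ * ‖θ' x‖ ^ 2) / ε) * (1 + x) ^ (2 / ε) +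
        ‖θ' x‖ ^ 2 * (2 / ε * (1 + x) ^ (2 / ε) / (1 + x)) =
        2 / ε * (1 + x) ^ (2 / ε) * ‖θ' x‖ ^ 2 * ((1 + x)⁻¹ - ((1 + x) ^ p)⁻¹) := by ring
    rw [e]
    exact mul_nonpos_of_nonneg_of_nonpos (by positivity) (by linarith)

end Layer

lemma add_integral_le_of_deriv_le {Y Y' w : ℝ → ℝ} {T : ℝ} (hT : 0 ≤ T)
    (hY : ∀ t, 0 ≤ t → HasDerivWithinAt Y (Y' t) (Set.Ici 0) t)
    (hw : ContinuousOn w (Set.Ici 0)) (h : ∀ t ∈ Set.Icc 0 T, Y' t ≤ -w t) :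
    Y T + ∫ t in (0:ℝ)..T, w t ≤ Y 0 := by
  have h1 := sub_le_integral_of_hasDeriv_right_of_le (g := Y) (g' := Y') (φ := fun t => -w t) hT
    (fun t ht => ((hY t ht.1).mono Set.Icc_subset_Ici_self).continuousWithinAt)
    (fun t ht => (hY t ht.1.le).mono fun x hx => ht.1.le.trans (le_of_lt hx))
    ((hw.neg.mono Set.Icc_subset_Ici_self).integrableOn_Icc) (fun t ht => h t ⟨ht.1.le, ht.2.le⟩)
  rw [intervalIntegral.integral_neg] at h1
  linarith

lemma closing_estimate {H : Type*} [NormedAddCommGroup H] [InnerProductSpace ℝ H]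
    {p ε K C₁ C₂ C₃ J₀ : ℝ} {ρ : ℝ → H} {Z Z' J J' w : ℝ → ℝ}
    (hp0 : 0 ≤ p) (hp1 : p ≤ 1) (hε : 0 < ε) (hε' : ε ≤ 1 / 8) (hK : 0 < K) (hC₁ : 0 ≤ C₁)
    (hC₂ : 0 ≤ C₂) (hC₃ : 0 ≤ C₃) (hJ₀ : J₀ = -J 0)
    (hZ : ∀ t, 0 ≤ t → HasDerivWithinAt Z (Z' t) (Set.Ici 0) t) (hZ0 : Z 0 = 0)
    (hZρ : ∀ t, 0 ≤ t → K * (‖ρ t‖ ^ 2 / 4) ≤ Z t)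
    (hρ : ContinuousOn ρ (Set.Ici 0)) (hJ : ∀ t, 0 ≤ t → J t ≤ 0)
    (hJ' : ∀ t, 0 ≤ t → HasDerivWithinAt J (J' t) (Set.Ici 0) t)
    (hw : ContinuousOn w (Set.Ici 0)) (hw0 : ∀ t, 0 ≤ t → 0 ≤ w t)
    (h : ∀ t S, 0 ≤ t → ‖ρ t‖ ≤ S → Z' t ≤ -w t + K * (C₁ * S * (1 + t) ^ (2 - 1 / ε) +
      ε / 2 * (p * (1 - p) * ((1 + t) ^ p / (1 + t) ^ 2)) * S ^ 2 +
      ε * (C₂ * (1 + t) ^ (2 - 1 / ε))) + ε ^ 2 * (C₃ * J' t)) {T : ℝ} (hT : 0 ≤ T) :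
    K * (‖ρ T‖ ^ 2 / 4) + ∫ t in (0:ℝ)..T, w t ≤
      (2 * K * (C₁ * √(2 * (64 * C₁ ^ 2 + 8 * C₂ + 4 * C₃ * J₀ / K)) + C₂) +
        K * (64 * C₁ ^ 2 + 8 * C₂ + 4 * C₃ * J₀ / K) + C₃ * J₀) * ε ^ 2 := by
  have hJ₀0 : 0 ≤ J₀ := by rw [hJ₀]; linarith [hJ 0 le_rfl]
  have hε3 : 0 < 1 / ε - 3 := by
    have : 8 ≤ 1 / ε := by rw [le_div_iff₀ hε]; linarith
    linarith
  have hε2 : 1 / (1 / ε - 3) ≤ 2 * ε := by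
    rw [div_le_iff₀ hε3]
    have : 2 * ε * (1 / ε - 3) = 2 - 6 * ε := by field_simp; ring
    linarith
  have main : ∀ T S, 0 ≤ T → 0 ≤ S → (∀ t ∈ Set.Icc 0 T, ‖ρ t‖ ≤ S) →
      K * (‖ρ T‖ ^ 2 / 4) + ∫ t in (0:ℝ)..T, w t ≤
        2 * K * ε * (C₁ * S + ε * C₂) + K * ε / 2 * S ^ 2 + ε ^ 2 * (C₃ * J₀) := by
    intro T S hT hS hρS
    have key := add_integral_le_of_deriv_le hT
      (Y := fun t => Z t + K * ((C₁ * S + ε * C₂) * ((1 + t) ^ (3 - 1 / ε) / (1 / ε - 3))) +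
        K * ε / 2 * S ^ 2 * p * ((1 + t) ^ p / (1 + t)) - ε ^ 2 * C₃ * J t)
      (Y' := fun t => Z' t - K * ((C₁ * S + ε * C₂) * (1 + t) ^ (2 - 1 / ε)) -
        K * ε / 2 * S ^ 2 * p * ((1 - p) * ((1 + t) ^ p / (1 + t) ^ 2)) - ε ^ 2 * C₃ * J' t)
      ?_ hw ?_
    · simp only [add_zero, Real.one_rpow, hZ0] at key
      have hs : 0 < 1 + T := by linarith
      have e1 := hZρ T hT
      have e2 : 0 ≤ K * ((C₁ * S + ε * C₂) * ((1 + T) ^ (3 - 1 / ε) / (1 / ε - 3))) := by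
        positivity
      have e3 : 0 ≤ K * ε / 2 * S ^ 2 * p * ((1 + T) ^ p / (1 + T)) := by positivity
      have e4 : ε ^ 2 * C₃ * J T ≤ 0 :=
        mul_nonpos_of_nonneg_of_nonpos (by positivity) (hJ T hT)
      have e5 : K * ((C₁ * S + ε * C₂) * (1 / (1 / ε - 3))) ≤ K * ((C₁ * S + ε * C₂) * (2 * ε)) := by
        gcongr
      have e6 : K * ε / 2 * S ^ 2 * p * (1 / 1) ≤ K * ε / 2 * S ^ 2 * 1 * (1 / 1) := by gcongr
      have e7 : J 0 = -J₀ := by linarith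
      rw [e7] at key
      linarith
    · intro t ht
      have hs : 0 < 1 + t := by linarith
      have ds : HasDerivWithinAt (fun t : ℝ => 1 + t) 1 (Set.Ici 0) t :=
        (hasDerivWithinAt_id t _).const_add 1
      have d1 : HasDerivWithinAt (fun t : ℝ => (1 + t) ^ (3 - 1 / ε) / (1 / ε - 3))
          (-(1 + t) ^ (2 - 1 / ε)) (Set.Ici 0) t := by
        refine ((hasDerivWithinAt_one_add_rpow (3 - 1 / ε) ht).div_const _).congr_deriv ?_
        have e : (1 + t) ^ (3 - 1 / ε) = (1 + t) ^ (2 - 1 / ε) * (1 + t) := by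
          rw [← Real.rpow_add_one hs.ne']; congr 1; ring
        rw [e]
        generalize 1 / ε = m at *
        have := hε3.ne'
        field_simp
        ring
      have d2 : HasDerivWithinAt (fun t : ℝ => (1 + t) ^ p / (1 + t))
          (-((1 - p) * ((1 + t) ^ p / (1 + t) ^ 2))) (Set.Ici 0) t := by
        refine ((hasDerivWithinAt_one_add_rpow p ht).fun_div ds hs.ne').congr_deriv ?_
        field_simp
        ring
      refine ((((hZ t ht).fun_add ((d1.const_mul _).const_mul K)).fun_add
        (d2.const_mul _)).fun_sub ((hJ' t ht).const_mul _)).congr_deriv ?_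
      ring
    · intro t ht
      have := h t S ht.1 (hρS t ht)
      linarith
  have hcont : ContinuousOn (fun t => ‖ρ t‖) (Set.Icc 0 T) := hρ.norm.mono Set.Icc_subset_Ici_self
  obtain ⟨t₀, ht₀, hmax⟩ := isCompact_Icc.exists_isMaxOn (Set.nonempty_Icc.2 hT) hcont
  set S := ‖ρ t₀‖ with hS
  set R := 64 * C₁ ^ 2 + 8 * C₂ + 4 * C₃ * J₀ / K with hR
  have hR0 : 0 ≤ R := by positivity
  have hSR : S ^ 2 ≤ 2 * R * ε ^ 2 := by
    have h1 := main t₀ S ht₀.1 (norm_nonneg _)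
      (fun t ht => hmax ⟨ht.1, ht.2.trans ht₀.2⟩)
    have h2 : 0 ≤ ∫ t in (0:ℝ)..t₀, w t :=
      intervalIntegral.integral_nonneg ht₀.1 fun t ht => hw0 t ht.1
    have h3 : K * (S ^ 2 / 4) ≤ K * (2 * ε * (C₁ * S + ε * C₂) + ε / 2 * S ^ 2 +
        ε ^ 2 * (C₃ * J₀ / K)) := by
      have e : K * (2 * ε * (C₁ * S + ε * C₂) + ε / 2 * S ^ 2 + ε ^ 2 * (C₃ * J₀ / K)) =
        2 * K * ε * (C₁ * S + ε * C₂) + K * ε / 2 * S ^ 2 + ε ^ 2 * (C₃ * J₀) := by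
        field_simp
      rw [e]; linarith
    have h4 := le_of_mul_le_mul_left h3 hK
    have h5 : ε * S ^ 2 ≤ 1 / 8 * S ^ 2 := by gcongr
    have h6 : 0 ≤ (S - 16 * ε * C₁) ^ 2 := sq_nonneg _
    have h7 : R * ε ^ 2 = 64 * C₁ ^ 2 * ε ^ 2 + 8 * C₂ * ε ^ 2 + 4 * ε ^ 2 * (C₃ * J₀ / K) := by
      rw [hR]; ring
    nlinarith
  have hS' : S ≤ √(2 * R) * ε := by
    apply abs_le_of_sq_le_sq' _ (by positivity) |>.2
    rw [mul_pow, Real.sq_sqrt (by positivity)]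
    exact hSR
  have h1 := main T (√(2 * R) * ε) hT (by positivity) (fun t ht => (hmax ht).trans hS')
  have h2 : (√(2 * R) * ε) ^ 2 = 2 * R * ε ^ 2 := by
    rw [mul_pow, Real.sq_sqrt (by positivity)]
  rw [h2] at h1
  have h3 : K * ε / 2 * (2 * R * ε ^ 2) ≤ K * R * ε ^ 2 := by
    have : ε * (K * R * ε ^ 2) ≤ 1 * (K * R * ε ^ 2) := by gcongr; linarith
    linarith
  linarith

section Solutions

variable {H : Type*} [NormedAddCommGroup H] [InnerProductSpace ℝ H]
  {A : H →L[ℝ] H} {p γ : ℝ}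

lemma IsHypSolution.hypScalars (hA_sa : ∀ x y : H, ⟪A x, y⟫ = ⟪x, A y⟫)
    (hA_nn : ∀ x : H, 0 ≤ ⟪A x, x⟫) {ε : ℝ} (hε : 0 < ε) {u₀ u₁ : H} {u u' u'' : ℝ → H}
    (hu : IsHypSolution A p γ ε u₀ u₁ u u' u'') :
    HypScalars p γ ε (fun t => ⟪A (u t), u t⟫) (fun t => ⟪A (u t), u' t⟫)
      (fun t => ⟪A (u' t), u' t⟫) (fun t => ‖A (u t)‖ ^ 2) (fun t => ⟪A (u t), A (u' t)⟫) := by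
  obtain ⟨-, -, hd, hd', -, heq⟩ := hu
  have hsymm : ∀ x y : H, ⟪A x, y⟫ = ⟪A y, x⟫ := fun x y => by rw [hA_sa, real_inner_comm]
  have hAd : ∀ t, 0 ≤ t → HasDerivWithinAt (fun t => A (u t)) (A (u' t)) (Set.Ici 0) t :=
    fun t ht => A.hasFDerivAt.comp_hasDerivWithinAt t (hd t ht)
  have hAd' : ∀ t, 0 ≤ t → HasDerivWithinAt (fun t => A (u' t)) (A (u'' t)) (Set.Ici 0) t :=
    fun t ht => A.hasFDerivAt.comp_hasDerivWithinAt t (hd' t ht)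
  have hu'' : ∀ t, 0 ≤ t → ∀ z, ⟪z, u'' t⟫ =
      -(⟪z, u' t⟫ / (1 + t) ^ p + ⟪A (u t), u t⟫ ^ γ * ⟪z, A (u t)⟫) / ε := by
    intro t ht z
    have h1 := congrArg (fun y => ⟪z, y⟫) (heq t ht)
    simp only [inner_add_right, real_inner_smul_right, inner_zero_right,
      Real.rpow_neg (by linarith : 0 ≤ 1 + t)] at h1
    rw [eq_div_iff hε.ne']
    linear_combination h1
  refine ⟨fun t ht => ?_, fun t ht => ?_, fun t ht => ?_, fun t ht => ?_, fun t _ => hA_nn _,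
    fun t _ => sq_nonneg _, fun t _ => inner_map_sq_le A hA_sa hA_nn _ _⟩
  · refine ((hAd t ht).inner ℝ (hd t ht)).congr_deriv ?_
    rw [hsymm (u' t)]; ring
  · refine ((hAd t ht).inner ℝ (hd' t ht)).congr_deriv ?_
    rw [hu'' t ht, real_inner_self_eq_norm_sq]; ring
  · refine ((hAd' t ht).inner ℝ (hd' t ht)).congr_deriv ?_
    rw [hsymm (u'' t), hu'' t ht, real_inner_comm (A (u t))]; ring
  · exact (hAd t ht).norm_sq

lemma IsParSolution.deriv_eq {u₀ : H} {u u' : ℝ → H} (hu : IsParSolution A p γ u₀ u u') {t : ℝ}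
    (ht : 0 ≤ t) : u' t = -((1 + t) ^ p * ⟪A (u t), u t⟫ ^ γ) • A (u t) := by
  rw [neg_smul]
  exact eq_neg_of_add_eq_zero_left (hu.2.2.2 t ht)

lemma IsParSolution.parScalars (hA_sa : ∀ x y : H, ⟪A x, y⟫ = ⟪x, A y⟫)
    (hA_nn : ∀ x : H, 0 ≤ ⟪A x, x⟫) {u₀ : H} {u u' : ℝ → H}
    (hu : IsParSolution A p γ u₀ u u') :
    ParScalars p γ ‖A‖ (fun t => ⟪A (u t), u t⟫) (fun t => ‖A (u t)‖ ^ 2)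
      (fun t => ⟪A (A (u t)), A (u t)⟫) (fun t => ‖A (A (u t))‖ ^ 2) (fun t => ‖u t‖ ^ 2) := by
  have hd : ∀ t, 0 ≤ t → HasDerivWithinAt u
      (-((1 + t) ^ p * ⟪A (u t), u t⟫ ^ γ) • A (u t)) (Set.Ici 0) t := fun t ht => by
    rw [← hu.deriv_eq ht]; exact hu.2.1 t ht
  have hsymm : ∀ x y : H, ⟪A x, y⟫ = ⟪A y, x⟫ := fun x y => by rw [hA_sa, real_inner_comm]
  have hAd : ∀ t, 0 ≤ t → HasDerivWithinAt (fun t => A (u t))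
      (-((1 + t) ^ p * ⟪A (u t), u t⟫ ^ γ) • A (A (u t))) (Set.Ici 0) t := fun t ht => by
    have := A.hasFDerivAt.comp_hasDerivWithinAt t (hd t ht)
    rwa [map_smul] at this
  have hAAd : ∀ t, 0 ≤ t → HasDerivWithinAt (fun t => A (A (u t)))
      (-((1 + t) ^ p * ⟪A (u t), u t⟫ ^ γ) • A (A (A (u t)))) (Set.Ici 0) t := fun t ht => by
    have := A.hasFDerivAt.comp_hasDerivWithinAt t (hAd t ht)
    rwa [map_smul] at this
  refine ⟨fun t ht => ?_, fun t ht => ?_, fun t ht => ?_, fun t ht => ?_, fun t _ => hA_nn _,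
    fun t _ => sq_nonneg _, fun t _ => hA_nn _, fun t _ => sq_nonneg _, fun t _ => sq_nonneg _,
    fun t _ => ?_, fun t _ => norm_map_sq_le A hA_sa hA_nn _, norm_nonneg _⟩
  · refine ((hAd t ht).inner ℝ (hd t ht)).congr_deriv ?_
    rw [real_inner_smul_left, real_inner_smul_right, hA_sa (A (u t)), real_inner_self_eq_norm_sq]
    ring
  · refine (hAd t ht).norm_sq.congr_deriv ?_
    rw [real_inner_smul_right, ← hA_sa]
    ring
  · refine ((hAAd t ht).inner ℝ (hAd t ht)).congr_deriv ?_
    rw [real_inner_smul_left, real_inner_smul_right, hA_sa (A (A (u t))),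
      real_inner_self_eq_norm_sq]
    ring
  · refine (hd t ht).norm_sq.congr_deriv ?_
    rw [real_inner_smul_right, ← hA_sa]
    ring
  · have := inner_map_sq_le A hA_sa hA_nn (u t) (A (u t))
    rwa [real_inner_self_eq_norm_sq] at this

lemma inner_map_sub_self_le (hA_sa : ∀ x y : H, ⟪A x, y⟫ = ⟪x, A y⟫)
    (hA_nn : ∀ x : H, 0 ≤ ⟪A x, x⟫) (x y : H) :
    ⟪A (x - y), x - y⟫ ≤ 2 * ⟪A x, x⟫ + 2 * ⟪A y, y⟫ := by
  have h := hA_nn (x + y)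
  have h' : ⟪A y, x⟫ = ⟪A x, y⟫ := by rw [hA_sa, real_inner_comm]
  simp only [map_sub, map_add, inner_sub_left, inner_sub_right, inner_add_left, inner_add_right,
    h'] at h ⊢
  linarith

/-- The second derivative of a solution of the parabolic equation lies in the range of `A`. -/
lemma IsParSolution.exists_hasDerivWithinAt (hA_sa : ∀ x y : H, ⟪A x, y⟫ = ⟪x, A y⟫)
    (hA_nn : ∀ x : H, 0 ≤ ⟪A x, x⟫) {u₀ : H} {u u' : ℝ → H}
    (hu : IsParSolution A p γ u₀ u u') {t : ℝ} (ht : 0 ≤ t) (hc : 0 < ⟪A (u t), u t⟫) :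
    ∃ v, HasDerivWithinAt u' (A v) (Set.Ici 0) t ∧ ∃ k k' : ℝ,
      k = (1 + t) ^ p * ⟪A (u t), u t⟫ ^ γ ∧
      k' = k * (p / (1 + t) - 2 * γ * k * (‖A (u t)‖ ^ 2 / ⟪A (u t), u t⟫)) ∧
      ⟪A v, v⟫ ≤ 2 * k' ^ 2 * ⟪A (u t), u t⟫ + 2 * k ^ 4 * ⟪A (A (u t)), A (u t)⟫ ∧
      ‖A v‖ ^ 2 ≤ 2 * k' ^ 2 * ‖A (u t)‖ ^ 2 + 2 * k ^ 4 * ‖A (A (u t))‖ ^ 2 := by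
  have hs : 0 < 1 + t := by linarith
  have hB : 0 < (1 + t) ^ p := Real.rpow_pos_of_pos hs _
  have hcγ : 0 < ⟪A (u t), u t⟫ ^ γ := Real.rpow_pos_of_pos hc _
  obtain ⟨k, hk⟩ : ∃ k, k = (1 + t) ^ p * ⟪A (u t), u t⟫ ^ γ := ⟨_, rfl⟩
  obtain ⟨k', hk'⟩ : ∃ k', k' =
    k * (p / (1 + t) - 2 * γ * k * (‖A (u t)‖ ^ 2 / ⟪A (u t), u t⟫)) := ⟨_, rfl⟩
  refine ⟨k ^ 2 • A (u t) - k' • u t, ?_, k, k', hk, hk', ?_, ?_⟩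
  · have hAd := A.hasFDerivAt.comp_hasDerivWithinAt t (hu.2.1 t ht)
    have dk := (hasDerivWithinAt_one_add_rpow p ht).fun_mul
      (((hu.parScalars hA_sa hA_nn).deriv_c t ht).rpow_of_pos γ hc)
    have h := dk.fun_neg.fun_smul hAd
    refine (h.congr (fun x hx => hu.deriv_eq hx) (hu.deriv_eq ht)).congr_deriv ?_
    rw [hu.deriv_eq ht, ← hk, Function.comp_apply]
    have e : p * (1 + t) ^ p / (1 + t) * ⟪A (u t), u t⟫ ^ γ + (1 + t) ^ p *
        (γ * (-2 * k * ‖A (u t)‖ ^ 2 / ⟪A (u t), u t⟫) * ⟪A (u t), u t⟫ ^ γ) = k' := by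
      rw [hk']
      nth_rewrite 2 [hk]
      ring
    simp only [e, map_sub, map_smul]
    module
  · refine (inner_map_sub_self_le hA_sa hA_nn _ _).trans (le_of_eq ?_)
    simp only [map_smul, real_inner_smul_left, real_inner_smul_right]
    ring
  · have h1 := parallelogram_law_with_norm ℝ (A (k ^ 2 • A (u t))) (A (k' • u t))
    rw [map_sub]
    have h2 : ‖A (k ^ 2 • A (u t))‖ ^ 2 = k ^ 4 * ‖A (A (u t))‖ ^ 2 := by
      rw [map_smul, norm_smul, mul_pow, Real.norm_eq_abs, sq_abs]; ring
    have h3 : ‖A (k' • u t)‖ ^ 2 = k' ^ 2 * ‖A (u t)‖ ^ 2 := by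
      rw [map_smul, norm_smul, mul_pow, Real.norm_eq_abs, sq_abs]
    nlinarith [sq_nonneg ‖A (k ^ 2 • A (u t)) + A (k' • u t)‖]

end Solutions

/-- The coefficient `2 / (⟨Ay,y⟩^{-γ} + ⟨Ax,x⟩^{-γ})` along two trajectories grows at most
polynomially. -/
lemma exists_hasDerivWithinAt_harmonic {γ M t X' Y' : ℝ} {X Y : ℝ → ℝ} (hM : 0 ≤ M) (hγ : 0 ≤ γ)
    (ht : 0 ≤ t) (hX : 0 < X t) (hY : 0 < Y t) (dX : HasDerivWithinAt X X' (Set.Ici 0) t)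
    (dY : HasDerivWithinAt Y Y' (Set.Ici 0) t) (hX' : 0 ≤ X')
    (hY' : -(2 * γ * M / (1 + t) * Y t) ≤ Y') :
    ∃ lam', HasDerivWithinAt (fun t => 2 / (X t + Y t)) lam' (Set.Ici 0) t ∧
      lam' ≤ 2 * γ * M / (1 + t) * (2 / (X t + Y t)) := by
  have hpos : 0 < X t + Y t := by positivity
  refine ⟨_, ((hasDerivWithinAt_const t (Set.Ici 0) (2:ℝ)).fun_div (dX.fun_add dY) hpos.ne'), ?_⟩
  rw [div_le_iff₀ (by positivity)]
  have e : 2 * γ * M / (1 + t) * (2 / (X t + Y t)) * (X t + Y t) ^ 2 =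
      2 * (2 * γ * M / (1 + t) * X t) + 2 * (2 * γ * M / (1 + t) * Y t) := by
    field_simp
  have h : 0 ≤ 2 * γ * M / (1 + t) * X t := by positivity
  rw [e]
  linarith

/-- The sum of the two energy rates, with the initial layer and the parabolic remainder absorbed. -/
lemma total_rate_le {K K₀ ε L a w τ S B D ϑ V W X N E J' : ℝ} (hK : K = 1 + 8 * K₀)
    (hK₀ : 0 ≤ K₀) (hε : 0 < ε) (hL : 0 ≤ L) (ha : 0 ≤ a) (hS : 0 ≤ S) (hB : 0 ≤ B) (hD : 0 ≤ D)
    (l1 : B ^ 2 * ϑ ≤ w * τ) (l2 : B * ϑ ^ 2 ≤ w ^ 2 * τ) (j1 : B * V * X ≤ J')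
    (j2 : B ^ 3 * W ^ 2 ≤ J') :
    K * (-(B * D / 2) + (1 + 8 * L * a) * S * (B ^ 2 * ϑ) + E * S ^ 2 + ε * (B * ϑ ^ 2) +
        ε ^ 2 * (2 * (B * V * X) + 4 * (B ^ 3 * W ^ 2))) +
      (-N + 4 * K₀ * (B * D) + ε ^ 2 * (4 * (B * (L * V) * X))) ≤
    -N + K * ((1 + 8 * L * a) * w * S * τ + E * S ^ 2 + ε * (w ^ 2 * τ)) +
      ε ^ 2 * ((6 * K + 4 * L) * J') := by
  have hK0 : 0 ≤ K := by rw [hK]; positivity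
  have l1' := mul_le_mul_of_nonneg_left l1 (by positivity : 0 ≤ K * ((1 + 8 * L * a) * S))
  have l2' := mul_le_mul_of_nonneg_left l2 (by positivity : 0 ≤ K * ε)
  have j1' := mul_le_mul_of_nonneg_left j1 (by positivity : 0 ≤ ε ^ 2 * (2 * K + 4 * L))
  have j2' := mul_le_mul_of_nonneg_left j2 (by positivity : 0 ≤ ε ^ 2 * (4 * K))
  have hKD : 8 * K₀ * (B * D) ≤ K * (B * D) := by gcongr; linarith
  linarith

section Estimate

variable {H : Type*} [NormedAddCommGroup H] [InnerProductSpace ℝ H]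
  {A : H →L[ℝ] H} {p γ : ℝ}

set_option maxHeartbeats 1000000 in
/-- The error estimate for a single `ε`, with an explicit constant, given decay bounds on the
hyperbolic and parabolic solutions. -/
lemma error_estimate_of_bounds
    (hA_sa : ∀ x y : H, ⟪A x, y⟫ = ⟪x, A y⟫) (hA_nn : ∀ x : H, 0 ≤ ⟪A x, x⟫)
    (hp0 : 0 ≤ p) (hp1 : p ≤ 1) (hγ : 1 ≤ γ) {u₀ u₁ : H} (hmdg : 0 < ⟪A u₀, u₀⟫)
    {u u' : ℝ → H} (hu : IsParSolution A p γ u₀ u u')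
    {ε M C C' K₀ K C₁ C₂ C₃ J₀ : ℝ} {J J' : ℝ → ℝ} (hε : 0 < ε) (hε' : ε ≤ 1 / 8)
    (hM : 0 ≤ M) (hC : 0 ≤ C) (hC' : 0 ≤ C')
    (hεC : 16 * ε * (4 + 4 * γ * M + 4 * C * γ) ≤ 1 / 4) (hεC' : 2 * γ * C * ε ≤ 1 / 2)
    (hK₀ : K₀ = 4 * ‖A‖ + 4 * γ * ‖A‖ + 4 * γ * C * C') (hK : K = 1 + 8 * K₀)
    (hC₁ : C₁ = (1 + 8 * ‖A‖ * ⟪A u₀, u₀⟫ ^ γ) * ‖u₁ + (⟪A u₀, u₀⟫ ^ γ) • A u₀‖)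
    (hC₂ : C₂ = ‖u₁ + (⟪A u₀, u₀⟫ ^ γ) • A u₀‖ ^ 2) (hC₃ : C₃ = 6 * K + 4 * ‖A‖) (hJ₀ : J₀ = -J 0)
    (hJ : ∀ t, 0 ≤ t → J t ≤ 0)
    (dJ : ∀ t, 0 ≤ t → HasDerivWithinAt J (J' t) (Set.Ici 0) t)
    (hJ' : ∀ t, 0 ≤ t → ∀ k k', k = (1 + t) ^ p * ⟪A (u t), u t⟫ ^ γ →
      k' = k * (p / (1 + t) - 2 * γ * k * (‖A (u t)‖ ^ 2 / ⟪A (u t), u t⟫)) →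
      (1 + t) ^ p * (2 * k' ^ 2 * ⟪A (u t), u t⟫ + 2 * k ^ 4 * ⟪A (A (u t)), A (u t)⟫) *
        ⟪A (u t), u t⟫ ^ (-γ) ≤ J' t ∧
      ((1 + t) ^ p) ^ 3 * (2 * k' ^ 2 * ‖A (u t)‖ ^ 2 + 2 * k ^ 4 * ‖A (A (u t))‖ ^ 2) ≤ J' t)
    (hgu : ∀ t, 0 ≤ t → ‖A (u t)‖ ^ 2 / ⟪A (u t), u t⟫ * ((1 + t) ^ p * (1 + t)) ≤
      C * ⟪A (u t), u t⟫ ^ (-γ))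
    (hcu : ∀ t, 0 ≤ t → ⟪A (u t), u t⟫ ^ (-γ) ≤ C' * ((1 + t) ^ p * (1 + t)))
    {uε uε' uε'' : ℝ → H} (huε : IsHypSolution A p γ ε u₀ u₁ uε uε' uε'')
    (hb : ∀ t, 0 ≤ t → 0 < ⟪A (uε t), uε t⟫ ∧
      |⟪A (uε t), uε' t⟫| * (1 + t) ≤ M * ⟪A (uε t), uε t⟫ ∧
      ‖A (uε t)‖ ^ 2 / ⟪A (uε t), uε t⟫ * ((1 + t) ^ p * (1 + t)) ≤
        C * ⟪A (uε t), uε t⟫ ^ (-γ))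
    {θ θ' θ'' : ℝ → H}
    (hθ : IsCorrector p ε (u₁ + (⟪A u₀, u₀⟫ ^ γ) • A u₀) θ θ' θ'') {T : ℝ} (hT : 0 ≤ T) :
    K * (‖uε T - u T‖ ^ 2 / 4) + ∫ t in (0:ℝ)..T,
        ‖uε' t - u' t - θ' t‖ ^ 2 * ⟪A (u t), u t⟫ ^ (-γ) * (1 + t) ^ (-p) ≤
      (2 * K * (C₁ * √(2 * (64 * C₁ ^ 2 + 8 * C₂ + 4 * C₃ * J₀ / K)) + C₂) +
        K * (64 * C₁ ^ 2 + 8 * C₂ + 4 * C₃ * J₀ / K) + C₃ * J₀) * ε ^ 2 := by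
  have Hp := hu.parScalars hA_sa hA_nn
  have Hh := huε.hypScalars hA_sa hA_nn hε
  have hγ0 : 0 ≤ γ := by linarith
  have hL := norm_nonneg A
  have hc0' : (0:ℝ) < ⟪A (u 0), u 0⟫ := by rw [hu.1]; exact hmdg
  have hc : ∀ t, 0 ≤ t → 0 < ⟪A (u t), u t⟫ := fun t ht => Hp.c_pos hp0 hp1 hγ hc0' ht
  have hcle : ∀ t, 0 ≤ t → ⟪A (u t), u t⟫ ^ γ ≤ ⟪A u₀, u₀⟫ ^ γ := fun t ht => by
    have := Hp.c_le ht
    simp only [hu.1] at this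
    exact Real.rpow_le_rpow (hA_nn _) this hγ0
  have ha0 : 0 ≤ ⟪A u₀, u₀⟫ ^ γ := Real.rpow_nonneg hmdg.le _
  have hK₀0 : 0 ≤ K₀ := by rw [hK₀]; positivity
  have hK0 : 0 < K := by rw [hK]; positivity
  have hX : ∀ t, 0 ≤ t → 0 < ⟪A (u t), u t⟫ ^ (-γ) := fun t ht => Real.rpow_pos_of_pos (hc t ht) _
  have hY : ∀ t, 0 ≤ t → 0 < ⟪A (uε t), uε t⟫ ^ (-γ) := fun t ht =>
    Real.rpow_pos_of_pos (hb t ht).1 _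
  have dX : ∀ t, 0 ≤ t → HasDerivWithinAt (fun t => ⟪A (u t), u t⟫ ^ (-γ))
      (2 * γ * (1 + t) ^ p * (‖A (u t)‖ ^ 2 / ⟪A (u t), u t⟫)) (Set.Ici 0) t := fun t ht =>
    Hp.hasDerivWithinAt_rpow_neg ht (hc t ht)
  have hlam : ∀ t, 0 ≤ t → ∃ lam', HasDerivWithinAt
      (fun t => 2 / (⟪A (u t), u t⟫ ^ (-γ) + ⟪A (uε t), uε t⟫ ^ (-γ))) lam' (Set.Ici 0) t ∧
      lam' ≤ 2 * γ * M / (1 + t) * (2 / (⟪A (u t), u t⟫ ^ (-γ) + ⟪A (uε t), uε t⟫ ^ (-γ))) := by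
    intro t ht
    have hs : 0 < 1 + t := by linarith
    have hB : 0 < (1 + t) ^ p := Real.rpow_pos_of_pos hs _
    obtain ⟨hb1, hb2, -⟩ := hb t ht
    refine exists_hasDerivWithinAt_harmonic (X := fun t => ⟪A (u t), u t⟫ ^ (-γ))
      (Y := fun t => ⟪A (uε t), uε t⟫ ^ (-γ)) hM hγ0 ht (hX t ht) (hY t ht) (dX t ht)
      ((Hh.deriv_c t ht).rpow_of_pos (-γ) hb1) ?_ ?_
    · have := hc t ht
      positivity
    · have h1 : ⟪A (uε t), uε' t⟫ / ⟪A (uε t), uε t⟫ ≤ M / (1 + t) := by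
        rw [div_le_div_iff₀ hb1 hs]
        exact (mul_le_mul_of_nonneg_right (le_abs_self _) hs.le).trans hb2
      have h2 : 2 * γ * (⟪A (uε t), uε' t⟫ / ⟪A (uε t), uε t⟫) * ⟪A (uε t), uε t⟫ ^ (-γ) ≤
          2 * γ * (M / (1 + t)) * ⟪A (uε t), uε t⟫ ^ (-γ) := by
        have := (hY t ht).le
        gcongr
      have e1 : -γ * (2 * ⟪A (uε t), uε' t⟫ / ⟪A (uε t), uε t⟫) * ⟪A (uε t), uε t⟫ ^ (-γ) =
        -(2 * γ * (⟪A (uε t), uε' t⟫ / ⟪A (uε t), uε t⟫) * ⟪A (uε t), uε t⟫ ^ (-γ)) := by ring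
      have e2 : 2 * γ * M / (1 + t) * ⟪A (uε t), uε t⟫ ^ (-γ) =
        2 * γ * (M / (1 + t)) * ⟪A (uε t), uε t⟫ ^ (-γ) := by ring
      simp only [e1, e2]
      linarith
  have hv := fun t (ht : 0 ≤ t) => hu.exists_hasDerivWithinAt hA_sa hA_nn ht (hc t ht)
  choose! lam' dlam hlam' using hlam
  choose! v dv k k' hk hk' hV hW using hv
  set ρ : ℝ → H := fun t => uε t - u t with hρ_def
  set q : ℝ → H := fun t => uε' t - u' t - θ' t with hq_def
  set lam : ℝ → ℝ := fun t => 2 / (⟪A (u t), u t⟫ ^ (-γ) + ⟪A (uε t), uε t⟫ ^ (-γ)) with hlam_def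
  set X : ℝ → ℝ := fun t => ⟪A (u t), u t⟫ ^ (-γ) with hX_def
  have dρ : ∀ t, 0 ≤ t → HasDerivWithinAt ρ (q t + θ' t) (Set.Ici 0) t := fun t ht =>
    ((huε.2.2.1 t ht).fun_sub (hu.2.1 t ht)).congr_deriv (by simp only [hq_def]; abel)
  have dq : ∀ t, 0 ≤ t → HasDerivWithinAt q (uε'' t - A (v t) - θ'' t) (Set.Ici 0) t := fun t ht =>
    ((huε.2.2.2.1 t ht).fun_sub (dv t ht)).fun_sub (hθ.2.2.2.1 t ht)
  have heq : ∀ t, 0 ≤ t → ε • (uε'' t - A (v t) - θ'' t) = -(((1 + t) ^ p)⁻¹ • q t +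
      ((⟪A (uε t), uε t⟫ ^ γ) • A (uε t) - (⟪A (u t), u t⟫ ^ γ) • A (u t)) + ε • A (v t)) := by
    intro t ht
    have hs : 0 < 1 + t := by linarith
    have hB : 0 < (1 + t) ^ p := Real.rpow_pos_of_pos hs _
    have h1 := huε.2.2.2.2.2 t ht
    have h2 := hθ.2.2.2.2 t ht
    rw [Real.rpow_neg hs.le] at h1 h2
    have h3 : ((1 + t) ^ p)⁻¹ • u' t = -((⟪A (u t), u t⟫ ^ γ) • A (u t)) := by
      rw [hu.deriv_eq ht, smul_smul, mul_neg, inv_mul_cancel_left₀ hB.ne', neg_smul]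
    rw [← sub_eq_zero] at h3
    simp only [hq_def, smul_sub]
    linear_combination (norm := module) h1 - h2 - h3
  have hlam0 : ∀ t, 0 ≤ t → 0 ≤ lam t := fun t ht => by
    have := hX t ht
    have := hY t ht
    simp only [hlam_def]; positivity
  have hq0 : q 0 = 0 := by
    simp only [hq_def, huε.2.1, hθ.2.1, hu.deriv_eq le_rfl, hu.1]
    simp
  have hρ0 : ρ 0 = 0 := by simp [hρ_def, huε.1, hu.1]
  refine closing_estimate (p := p) (ρ := ρ) (J := J) (J' := J')
    (Z := fun t => K * energy A p ε ρ q lam t + ε * (‖q t‖ ^ 2 * X t))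
    hp0 hp1 hε hε' hK0 ?_ ?_ ?_ hJ₀
    (fun t ht => ((hasDerivWithinAt_energy A hA_sa ht (dρ t ht) (dq t ht) (dlam t ht)
      (heq t ht)).const_mul K).fun_add
      (hasDerivWithinAt_weighted_norm_sq (dq t ht) (dX t ht) (heq t ht))) ?_ ?_ ?_ hJ dJ ?_ ?_ ?_ hT
  · rw [hC₁]; positivity
  · rw [hC₂]; positivity
  · rw [hC₃]; positivity
  · simp [energy, hq0, hρ0]
  · intro t ht
    have h1 := le_energy (q := q) A hp0 hp1 hε (by linarith) ht (hlam0 t ht) (hA_nn (ρ t))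
    have h2 := (hX t ht).le
    have h3 : 0 ≤ ε * (‖q t‖ ^ 2 * X t) := by positivity
    have h4 := mul_le_mul_of_nonneg_left h1 hK0.le
    linarith
  · exact fun t ht => (dρ t ht).continuousWithinAt
  · refine ContinuousOn.mul (ContinuousOn.mul ?_ ?_) ?_
    · exact (ContinuousOn.norm fun t ht => (dq t ht).continuousWithinAt).pow 2
    · exact fun t ht => (dX t ht).continuousWithinAt
    · exact fun t ht => (hasDerivWithinAt_one_add_rpow (-p) ht).continuousWithinAt
  · intro t ht
    have h2 := (hX t ht).le
    have hs : 0 < 1 + t := by linarith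
    positivity
  · intro t S ht hS
    have hs : 0 < 1 + t := by linarith
    obtain ⟨hB1, hB2⟩ := one_add_rpow_bounds hp0 hp1 ht
    obtain ⟨hD0, hDα, -, -⟩ := monotone_bounds A hA_sa hA_nn hγ (uε t) (u t)
    have hR := norm_sq_remainder_le A hA_sa hA_nn hγ (by linarith) hB2 hC (uε t) (u t)
      (hb t ht).1 (hc t ht) (hb t ht).2.2 (hgu t ht)
    have hF := norm_sq_smul_sub_smul_mul_le A hA_sa hA_nn hγ (by linarith) hs hC hC'
      (uε t) (u t) (hb t ht).1 (hc t ht) (hb t ht).2.2 (hcu t ht)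
    rw [← hK₀] at hF
    have hαX : ⟪A (u t), u t⟫ ^ γ * X t = 1 := by
      simp only [hX_def]
      rw [← Real.rpow_add (hc t ht)]; simp
    have hXt := hX t ht
    have hYt := hY t ht
    have hE := hA_nn (ρ t)
    have hlamα : lam t ≤ 2 * ⟪A (u t), u t⟫ ^ γ := by
      simp only [hlam_def]
      rw [div_le_iff₀ (by positivity)]
      have := Real.rpow_nonneg (hc t ht).le γ
      have := mul_nonneg this hYt.le
      linarith
    have r1 := energy_rate_le A hA_sa hA_nn (ϑ := θ' t) (q := q t) (v := v t) (a := ⟪A u₀, u₀⟫ ^ γ)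
      hp0 hp1 hε (by linarith) hB1 hB2 hD0 hM hγ0 hXt (by
        have := mul_le_mul_of_nonneg_right hDα hXt.le
        linear_combination this - ⟪A (ρ t), ρ t⟫ * hαX) (hlam0 t ht) (by
        have := mul_le_mul_of_nonneg_right hlamα hE
        linarith) (hlam' t ht) (hlamα.trans (by linarith [hcle t ht])) hR hS hεC
    have r2 := weighted_norm_sq_rate_le (q := q t) (Q := A (v t)) hε (by linarith) hB2 hXt hγ0 rfl
      (hgu t ht) hF (norm_map_sq_le A hA_sa hA_nn (v t)) hεC'
    obtain ⟨j1, j2⟩ := hJ' t ht (k t) (k' t) (hk t ht) (hk' t ht)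
    have j1' : (1 + t) ^ p * ⟪A (v t), v t⟫ * X t ≤ J' t := by
      refine le_trans ?_ j1
      have := hV t ht
      gcongr
    have j2' : ((1 + t) ^ p) ^ 3 * ‖A (v t)‖ ^ 2 ≤ J' t := by
      refine le_trans ?_ j2
      have := hW t ht
      gcongr
    have hθ1 := hθ.norm_le hp0 hp1 hε ht
    set w₀ := u₁ + (⟪A u₀, u₀⟫ ^ γ) • A u₀ with hw₀
    have hτ : (1 + t) ^ (2 - 1 / ε) = (1 + t) ^ 2 * (1 + t) ^ (-(1 / ε)) := by
      rw [sub_eq_add_neg, Real.rpow_add hs]; norm_num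
    have hτ1 : (1 + t) ^ (-(1 / ε)) ≤ 1 :=
      Real.rpow_le_one_of_one_le_of_nonpos (by linarith) (by simp [hε.le])
    have hS0 : 0 ≤ S := (norm_nonneg _).trans hS
    have l1 : ((1 + t) ^ p) ^ 2 * ‖θ' t‖ ≤ ‖w₀‖ * (1 + t) ^ (2 - 1 / ε) := by
      calc ((1 + t) ^ p) ^ 2 * ‖θ' t‖ ≤ (1 + t) ^ 2 * (‖w₀‖ * (1 + t) ^ (-(1 / ε))) := by gcongr
        _ = _ := by rw [hτ]; ring
    have l2 : (1 + t) ^ p * ‖θ' t‖ ^ 2 ≤ ‖w₀‖ ^ 2 * (1 + t) ^ (2 - 1 / ε) := by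
      have h1 : ‖θ' t‖ ≤ ‖w₀‖ := hθ1.trans (mul_le_of_le_one_right (norm_nonneg _) hτ1)
      calc (1 + t) ^ p * ‖θ' t‖ ^ 2 = ((1 + t) ^ p * ‖θ' t‖) * ‖θ' t‖ := by ring
        _ ≤ (((1 + t) ^ p) ^ 2 * ‖θ' t‖) * ‖w₀‖ := by
          gcongr
          nlinarith
        _ ≤ (‖w₀‖ * (1 + t) ^ (2 - 1 / ε)) * ‖w₀‖ := by gcongr
        _ = _ := by ring
    have m1 := mul_le_mul_of_nonneg_left r1 hK0.le
    refine (add_le_add m1 r2).trans ?_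
    rw [hC₁, hC₂, hC₃, Real.rpow_neg hs.le]
    exact total_rate_le hK hK₀0 hε hL ha0 hS0 (by linarith) hD0 l1 l2 j1' j2'

end Estimate

/-- Global-in-time error estimate (part 2 of Theorem 2.2, optimal rate): with `ρ_ε = u_ε - u` and
`r_ε = u_ε - u - θ_ε`, one has
`|ρ_ε(t)|² + ⟨Aρ_ε(t),ρ_ε(t)⟩ + ∫₀ᵗ |r_ε'|² ⟨Au,u⟩^{-γ} (1+s)^{-p} ds ≤ C₄ ε²`. -/
theorem globalErrorEstimateOptimal
    {H : Type*} [NormedAddCommGroup H] [InnerProductSpace ℝ H] [CompleteSpace H]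
    (A : H →L[ℝ] H)
    (hA_sa : ∀ x y : H, ⟪A x, y⟫ = ⟪x, A y⟫)
    (hA_nn : ∀ x : H, 0 ≤ ⟪A x, x⟫)
    (p γ : ℝ) (hp0 : 0 ≤ p) (hp1 : p ≤ 1) (hγ : 1 ≤ γ)
    (u₀ u₁ : H) (hmdg : 0 < ⟪A u₀, u₀⟫)
    (u u' : ℝ → H) (hu : IsParSolution A p γ u₀ u u')
    (hcoer_or_p : (∃ ν > 0, ∀ x : H, ν * ‖x‖ ^ 2 ≤ ⟪A x, x⟫) ∨
      p ≤ (γ ^ 2 + 1) / (γ ^ 2 + 2 * γ - 1)) :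
    ∃ ε₀ > 0, ∃ C₄ > 0, ∀ ε : ℝ, 0 < ε → ε < ε₀ →
      ∀ uε uε' uε'' : ℝ → H, IsHypSolution A p γ ε u₀ u₁ uε uε' uε'' →
      ∀ θ θ' θ'' : ℝ → H,
        IsCorrector p ε (u₁ + (⟪A u₀, u₀⟫ ^ γ) • A u₀) θ θ' θ'' →
      ∀ t ∈ Set.Ici (0:ℝ),
        ‖uε t - u t‖ ^ 2 + ⟪A (uε t - u t), uε t - u t⟫ +
          ∫ s in (0:ℝ)..t,
            ‖uε' s - u' s - θ' s‖ ^ 2 * ⟪A (u s), u s⟫ ^ (-γ) * (1+s) ^ (-p)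
        ≤ C₄ * ε ^ 2 := by
  have Hp := hu.parScalars hA_sa hA_nn
  have hc0 : (0:ℝ) < ⟪A (u 0), u 0⟫ := by rw [hu.1]; exact hmdg
  have hγ0 : 0 ≤ γ := by linarith
  obtain ⟨ε₁, hε₁, M, hM, Ch, hCh, hhyp⟩ := exists_hypScalars_bounds hp0 hp1 hγ hmdg
    (sq_nonneg ‖A u₀‖) (inner_map_sq_le A hA_sa hA_nn u₀ u₁)
  obtain ⟨J, J', hJ, dJ, hJ'⟩ := Hp.exists_antideriv hp0 hp1 hγ hc0
  obtain ⟨Cp, hCp⟩ : ∃ Cp, Cp = 1 + ‖A (u 0)‖ ^ 2 / ⟪A (u 0), u 0⟫ * ⟪A (u 0), u 0⟫ ^ γ :=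
    ⟨_, rfl⟩
  obtain ⟨C', hC'⟩ : ∃ C', C' = ⟪A (u 0), u 0⟫ ^ (-γ) + 2 * γ * ‖A‖ := ⟨_, rfl⟩
  have hCp0 : 0 ≤ Cp := by rw [hCp]; positivity
  have hC'0 : 0 ≤ C' := by rw [hC']; positivity
  obtain ⟨N, hN⟩ : ∃ N, N = 4 + 4 * γ * M + 4 * (Ch + Cp) * γ := ⟨_, rfl⟩
  have hNC : 4 * ((Ch + Cp) * γ) ≤ N := by
    have : 0 ≤ γ * M := by positivity
    linarith
  have hN0 : 0 < N := by rw [hN]; positivity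
  obtain ⟨K₀, hK₀⟩ : ∃ K₀, K₀ = 4 * ‖A‖ + 4 * γ * ‖A‖ + 4 * γ * (Ch + Cp) * C' := ⟨_, rfl⟩
  obtain ⟨K, hK⟩ : ∃ K, K = 1 + 8 * K₀ := ⟨_, rfl⟩
  obtain ⟨C₁, hC₁⟩ : ∃ C₁, C₁ = (1 + 8 * ‖A‖ * ⟪A u₀, u₀⟫ ^ γ) *
    ‖u₁ + (⟪A u₀, u₀⟫ ^ γ) • A u₀‖ := ⟨_, rfl⟩
  obtain ⟨C₂, hC₂⟩ : ∃ C₂, C₂ = ‖u₁ + (⟪A u₀, u₀⟫ ^ γ) • A u₀‖ ^ 2 := ⟨_, rfl⟩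
  have hK₀0 : 0 ≤ K₀ := by rw [hK₀]; positivity
  have hJ₀ : 0 ≤ -J 0 := by linarith [hJ 0 le_rfl]
  obtain ⟨R, hR⟩ : ∃ R, R = 2 * K * (C₁ * √(2 * (64 * C₁ ^ 2 + 8 * C₂ +
      4 * (6 * K + 4 * ‖A‖) * (-J 0) / K)) + C₂) + K * (64 * C₁ ^ 2 + 8 * C₂ +
      4 * (6 * K + 4 * ‖A‖) * (-J 0) / K) + (6 * K + 4 * ‖A‖) * (-J 0) := ⟨_, rfl⟩
  have hR0 : 0 ≤ R := by
    have : 0 ≤ K := by linarith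
    have : 0 ≤ C₁ := by rw [hC₁]; positivity
    have : 0 ≤ C₂ := by rw [hC₂]; positivity
    rw [hR]
    positivity
  refine ⟨min ε₁ (min (1 / 8) (1 / (64 * N))), by positivity, 4 * (1 + ‖A‖) * R + R + 1,
    by positivity, ?_⟩
  intro ε hε hεlt uε uε' uε'' huε θ θ' θ'' hθ t ht
  obtain ⟨h1, h2⟩ := lt_min_iff.1 hεlt
  obtain ⟨h2, h3⟩ := lt_min_iff.1 h2
  have hεN : ε * (64 * N) < 1 := (lt_div_iff₀ (by positivity)).1 h3
  have hb := hhyp ε hε h1 _ _ _ _ _ (huε.hypScalars hA_sa hA_nn hε) (by rw [huε.1])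
    (by rw [huε.1, huε.2.1]) (by rw [huε.2.1]) (by rw [huε.1])
  have key := error_estimate_of_bounds hA_sa hA_nn hp0 hp1 hγ hmdg hu hε h2.le hM.le
    (C := Ch + Cp) (by positivity) hC'0 (by rw [← hN]; linarith) (by nlinarith) hK₀ hK hC₁ hC₂
    rfl rfl hJ dJ hJ' (fun s hs => ?_)
    (fun s hs => by rw [hC']; exact Hp.rpow_neg_le hp0 hp1 hγ hc0 hs) huε (fun s hs => ?_) hθ ht
  · rw [← hR] at key
    have h_int : 0 ≤ ∫ s in (0:ℝ)..t,
        ‖uε' s - u' s - θ' s‖ ^ 2 * ⟪A (u s), u s⟫ ^ (-γ) * (1 + s) ^ (-p) :=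
      intervalIntegral.integral_nonneg ht fun s hs => by
        have h4 := Real.rpow_nonneg (hA_nn (u s)) (-γ)
        have h5 : 0 ≤ 1 + s := by linarith [hs.1]
        positivity
    have hρ : ‖uε t - u t‖ ^ 2 ≤ 4 * (R * ε ^ 2) := by
      have : 0 ≤ K₀ * ‖uε t - u t‖ ^ 2 := by positivity
      rw [hK] at key
      linarith
    have hI : 0 ≤ K * (‖uε t - u t‖ ^ 2 / 4) := by
      have : 0 ≤ K := by linarith
      positivity
    have hE : ⟪A (uε t - u t), uε t - u t⟫ ≤ ‖A‖ * ‖uε t - u t‖ ^ 2 := by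
      refine (real_inner_le_norm _ _).trans ?_
      rw [sq, ← mul_assoc]
      gcongr
      exact A.le_opNorm _
    have hE' : ‖A‖ * ‖uε t - u t‖ ^ 2 ≤ ‖A‖ * (4 * (R * ε ^ 2)) := by gcongr
    linarith [sq_nonneg ε]
  · have h4 := Hp.div_mul_le hp0 hp1 hγ hc0 hs
    have h5 := mul_nonneg hCh.le (Real.rpow_nonneg (hA_nn (u s)) (-γ))
    simp only [← hCp] at h4
    linarith
  · obtain ⟨b1, b2, b3⟩ := hb s hs
    have h5 := mul_nonneg hCp0 (Real.rpow_nonneg (hA_nn (uε s)) (-γ))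
    exact ⟨b1, b2, by linarith⟩
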